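/- Embed U_{n−1} in U_n as the subgroup of matrices whose first row vanishes off the diagonal, i.e. {u ∈ U_n : u_{ij} ≠ 0 for i ≠ j implies 2 ≤ i < j}. Then for every F_q-labeled set partition μ of {2,3,…,n}, Ind_{U_{n−1}}^{U_n}(χ^μ) = χ^{{1}} *_n χ^μ. In particular, the decomposition of induced supercharacters depends on the choice of embedding of U_{n−1} into U_n. -/

import Mathlib

/-!
STATEMENT 19: Embed U_{n−1} in U_n as the subgroup of matrices whose first row
vanishes off the diagonal, {u ∈ U_n : u_{ij} ≠ 0, i ≠ j ⟹ 2 ≤ i < j}.  Then for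
every F_q-labeled set partition μ of {2,…,n},
Ind_{U_{n−1}}^{U_n}(χ^μ) = χ^{{1}} *_n χ^μ.
(0-based indices: the 1-based condition 2 ≤ i reads 1 ≤ (i:ℕ).)
-/
open scoped Classical

noncomputable section

def setFinset {α : Type*} [Fintype α] (S : Set α) : Finset α :=
  Finset.univ.filter (· ∈ S)

/-- A strict partial order on `{1,…,n}` that is a subrelation of the usual order. -/
def IsPatternOrder {n : ℕ} (P : Fin n → Fin n → Prop) : Prop :=
  (∀ i j, P i j → i < j) ∧ ∀ i j k, P i j → P j k → P i k

/-- The pattern group `U_P` of unipotent upper-triangular matrices supported on `P`. -/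
def patternGroup (F : Type*) [Field F] {n : ℕ} (P : Fin n → Fin n → Prop) :
    Set (Matrix (Fin n) (Fin n) F) :=
  {u | (∀ i, u i i = 1) ∧ ∀ i j, i ≠ j → u i j ≠ 0 → P i j}

/-- `χ` is constant on the superclasses of `G`: `u ~ v` iff `v − 1 ∈ G(u−1)G`. -/
def IsSuperclassFn {A : Type*} [Ring A] (G : Set A) (χ : A → ℂ) : Prop :=
  ∀ u ∈ G, ∀ v ∈ G, (∃ x ∈ G, ∃ y ∈ G, v - 1 = x * (u - 1) * y) → χ u = χ v

/-- Superinduction `SInd_H^G(χ)(g) = (1/(|G||H|)) Σ_{x,y∈G} χ̇(x(g−1)y + 1)`. -/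
def SInd {A : Type*} [Ring A] [Fintype A] (G H : Set A) (χ : A → ℂ) (g : A) : ℂ :=
  (((setFinset G).card : ℂ) * ((setFinset H).card : ℂ))⁻¹ *
    ∑ x ∈ setFinset G, ∑ y ∈ setFinset G,
      if x * (g - 1) * y + 1 ∈ H then χ (x * (g - 1) * y + 1) else 0

/-- Induction `Ind_H^G(χ)(g) = (1/|H|) Σ_{y∈G} χ̇(y⁻¹ g y)`. -/
def Ind {A : Type*} [Ring A] [Fintype A] (G H : Set A) (χ : A → ℂ) (g : A) : ℂ :=
  ((setFinset H).card : ℂ)⁻¹ *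
    ∑ y ∈ setFinset G,
      if Ring.inverse y * g * y ∈ H then χ (Ring.inverse y * g * y) else 0

open Matrix

/-- The pairing `⟪a,b⟫ = Σ_{ij} a_{ij} b_{ij}`, identifying a matrix `a` with the
linear functional `b ↦ ⟪a,b⟫`. -/
def pairF {F : Type*} [Field F] {n : ℕ} (a b : Matrix (Fin n) (Fin n) F) : F :=
  ∑ i, ∑ j, a i j * b i j

/-- Projection of a matrix onto the entries supported on `P` (the matrix model of
restricting a functional to `n_P`). -/
def dproj {F : Type*} [Field F] {n : ℕ} (P : Fin n → Fin n → Prop)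
    (m : Matrix (Fin n) (Fin n) F) : Matrix (Fin n) (Fin n) F :=
  Matrix.of fun i j => if P i j then m i j else 0

/-- The left action `u·λ`, via `(uλ)(x−1) = λ(u⁻¹(x−1))`, in the matrix model:
`uλ = proj_P((u⁻¹)ᵀ λ)`. -/
def lact {F : Type*} [Field F] {n : ℕ} (P : Fin n → Fin n → Prop)
    (u lam : Matrix (Fin n) (Fin n) F) : Matrix (Fin n) (Fin n) F :=
  dproj P ((Ring.inverse u)ᵀ * lam)

/-- The right action `λ·v`, via `(λv)(x−1) = λ((x−1)v⁻¹)`:  `λv = proj_P(λ (v⁻¹)ᵀ)`. -/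
def ract {F : Type*} [Field F] {n : ℕ} (P : Fin n → Fin n → Prop)
    (lam v : Matrix (Fin n) (Fin n) F) : Matrix (Fin n) (Fin n) F :=
  dproj P (lam * (Ring.inverse v)ᵀ)

/-- The two-sided action `u·λ·v = proj_P((u⁻¹)ᵀ λ (v⁻¹)ᵀ)`. -/
def biact {F : Type*} [Field F] {n : ℕ} (P : Fin n → Fin n → Prop)
    (u lam v : Matrix (Fin n) (Fin n) F) : Matrix (Fin n) (Fin n) F :=
  dproj P ((Ring.inverse u)ᵀ * lam * (Ring.inverse v)ᵀ)

/-- The left orbit `U_P·λ`. -/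
def leftOrbit (F : Type*) [Field F] {n : ℕ} (P : Fin n → Fin n → Prop)
    (lam : Matrix (Fin n) (Fin n) F) : Set (Matrix (Fin n) (Fin n) F) :=
  {m | ∃ u ∈ patternGroup F P, m = lact P u lam}

/-- The right orbit `λ·U_P`. -/
def rightOrbit (F : Type*) [Field F] {n : ℕ} (P : Fin n → Fin n → Prop)
    (lam : Matrix (Fin n) (Fin n) F) : Set (Matrix (Fin n) (Fin n) F) :=
  {m | ∃ v ∈ patternGroup F P, m = ract P lam v}

/-- The two-sided orbit `U_P·λ·U_P`. -/
def biOrbit (F : Type*) [Field F] {n : ℕ} (P : Fin n → Fin n → Prop)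
    (lam : Matrix (Fin n) (Fin n) F) : Set (Matrix (Fin n) (Fin n) F) :=
  {m | ∃ u ∈ patternGroup F P, ∃ v ∈ patternGroup F P, m = biact P u lam v}

/-- The supercharacter
`χ^λ(u) = (|U_P λ|/|U_P λ U_P|) Σ_{μ ∈ U_P(−λ)U_P} θ(μ(u−1))`. -/
def superchar {F : Type*} [Field F] [Fintype F] {n : ℕ} (P : Fin n → Fin n → Prop)
    (θ : F → ℂ) (lam : Matrix (Fin n) (Fin n) F) (u : Matrix (Fin n) (Fin n) F) : ℂ :=
  (((setFinset (leftOrbit F P lam)).card : ℂ) / ((setFinset (biOrbit F P lam)).card : ℂ)) *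
    ∑ ν ∈ setFinset (biOrbit F P (-lam)), θ (pairF ν (u - 1))

/-- ℕ-indexed (1-based) matrix model of an F_q-labeled set partition:
`mu i j = t ≠ 0` encodes an arc `i ⌢_t j`. -/
abbrev SPF (F : Type*) := ℕ → ℕ → F

/-- Replace the `(i,k)` entry of `mu` by `t` (adjoin/delete/relabel an arc). -/
def updArc {F : Type*} (mu : SPF F) (i k : ℕ) (t : F) : SPF F :=
  fun a b => if a = i ∧ b = k then t else mu a b

/-- The combinatorial product `μ *_i {k}`, a formal ℕ-linear (here ℂ-linear)
combination of labeled set partitions, defined by the recursion of the paper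
(cases read in order). -/
noncomputable def lstar {F : Type*} [Field F] [Fintype F] (i k : ℕ) (mu : SPF F) :
    SPF F →₀ ℂ :=
  if h0 : k ≤ i then (if i = k then Finsupp.single mu 1 else 0)
  else if h2 : ∃ l, k < l ∧ mu i l ≠ 0 then (Fintype.card F) • lstar (i + 1) k mu
  else if h3 : mu i k ≠ 0 then lstar (i + 1) k (updArc mu i k 0)
  else if h4 : ∃ j, j < k ∧ mu i j ≠ 0 then
    lstar (i + 1) k mu +
      ∑ t ∈ Finset.univ.filter (fun t : F => t ≠ 0),
        lstar (i + 1) (Classical.choose h4)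
          (updArc (updArc mu i (Classical.choose h4) 0) i k t)
  else
    lstar (i + 1) k mu +
      ∑ t ∈ Finset.univ.filter (fun t : F => t ≠ 0), Finsupp.single (updArc mu i k t) 1
termination_by k - i
decreasing_by
  · omega
  · omega
  · omega
  · have := (Classical.choose_spec h4).1; omega
  · omega

/-- Convert the 1-based ℕ-indexed model to an `n × n` matrix (entry `(i,j)`, 0-based,
is `mu (i+1) (j+1)`). -/
def toMat (F : Type*) [Field F] (n : ℕ) (mu : SPF F) : Matrix (Fin n) (Fin n) F :=
  Matrix.of fun i j => mu ((i : ℕ) + 1) ((j : ℕ) + 1)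

/-- Extend `λ ↦ χ^λ` linearly: the class function `Σ_λ c_λ χ^λ` attached to a formal
combination `c` of labeled set partitions, the supercharacters taken for pattern `P`. -/
noncomputable def charOfComb {F : Type*} [Field F] [Fintype F] {n : ℕ}
    (P : Fin n → Fin n → Prop) (θ : F → ℂ) (c : SPF F →₀ ℂ)
    (g : Matrix (Fin n) (Fin n) F) : ℂ :=
  c.sum fun lam coeff => coeff * superchar P θ (toMat F n lam) g

/-- The combinatorial product `{j} *_l μ`, a formal combination of labeled set
partitions, defined by the recursion of the paper (cases read in order). -/
noncomputable def rstar {F : Type*} [Field F] [Fintype F] (j l : ℕ) (mu : SPF F) :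
    SPF F →₀ ℂ :=
  if h0 : l ≤ j then (if j = l then Finsupp.single mu 1 else 0)
  else if h2 : ∃ i, i < j ∧ mu i l ≠ 0 then (Fintype.card F) • rstar j (l - 1) mu
  else if h3 : mu j l ≠ 0 then rstar j (l - 1) (updArc mu j l 0)
  else if h4 : ∃ k, j < k ∧ mu k l ≠ 0 then
    rstar j (l - 1) mu +
      ∑ t ∈ Finset.univ.filter (fun t : F => t ≠ 0),
        rstar (Classical.choose h4) (l - 1)
          (updArc (updArc mu (Classical.choose h4) l 0) j l t)
  else
    rstar j (l - 1) mu +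
      ∑ t ∈ Finset.univ.filter (fun t : F => t ≠ 0), Finsupp.single (updArc mu j l t) 1
termination_by l - j
decreasing_by
  · omega
  · omega
  · omega
  · have := (Classical.choose_spec h4).1; omega
  · omega

open scoped BigOperators

lemma mem_setFinset {α : Type*} [Fintype α] {S : Set α} {a : α} :
    a ∈ setFinset S ↔ a ∈ S := by
  simp [setFinset]

section PatternGroup

variable {F : Type*} [Field F] {n : ℕ} {P : Fin n → Fin n → Prop}

lemma patternGroup_apply_eq_zero {u : Matrix (Fin n) (Fin n) F} (hu : u ∈ patternGroup F P)
    {i j : Fin n} (hij : i ≠ j) (h : ¬ P i j) : u i j = 0 := by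
  by_contra h0
  exact h (hu.2 i j hij h0)

lemma sub_one_apply_ne_zero {u : Matrix (Fin n) (Fin n) F} (hu : u ∈ patternGroup F P)
    {i j : Fin n} (h : (u - 1) i j ≠ 0) : P i j := by
  rcases eq_or_ne i j with rfl | hij
  · simp [hu.1 i] at h
  · rw [Matrix.sub_apply, Matrix.one_apply_ne hij, sub_zero] at h
    exact hu.2 i j hij h

lemma one_mem_patternGroup : (1 : Matrix (Fin n) (Fin n) F) ∈ patternGroup F P :=
  ⟨fun i => Matrix.one_apply_eq i, fun _ _ hij h => absurd (Matrix.one_apply_ne hij) h⟩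

lemma mul_mem_patternGroup (hP : IsPatternOrder P) {u v : Matrix (Fin n) (Fin n) F}
    (hu : u ∈ patternGroup F P) (hv : v ∈ patternGroup F P) : u * v ∈ patternGroup F P := by
  have key : ∀ i a j, u i a * v a j ≠ 0 → (i = a ∨ P i a) ∧ (a = j ∨ P a j) := by
    intro i a j h
    refine ⟨?_, ?_⟩
    · by_contra! h'
      exact h (by rw [patternGroup_apply_eq_zero hu h'.1 h'.2, zero_mul])
    · by_contra! h'
      exact h (by rw [patternGroup_apply_eq_zero hv h'.1 h'.2, mul_zero])
  refine ⟨fun i => ?_, fun i j hij h => ?_⟩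
  · rw [Matrix.mul_apply, Finset.sum_eq_single i, hu.1, hv.1, one_mul]
    · intro a _ hai
      by_contra h
      obtain ⟨h1 | h1, h2 | h2⟩ := key i a i h
      · exact hai h1.symm
      · exact hai h1.symm
      · exact hai h2
      · exact lt_asymm (hP.1 _ _ h1) (hP.1 _ _ h2)
    · simp
  · rw [Matrix.mul_apply] at h
    obtain ⟨a, -, ha⟩ := Finset.exists_ne_zero_of_sum_ne_zero h
    obtain ⟨rfl | h1, rfl | h2⟩ := key i a j ha
    · exact absurd rfl hij
    · exact h2
    · exact h1
    · exact hP.2 _ _ _ h1 h2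

lemma pow_mem_patternGroup (hP : IsPatternOrder P) {u : Matrix (Fin n) (Fin n) F}
    (hu : u ∈ patternGroup F P) (k : ℕ) : u ^ k ∈ patternGroup F P := by
  induction k with
  | zero => exact one_mem_patternGroup
  | succ k ih => rw [pow_succ]; exact mul_mem_patternGroup hP ih hu

lemma isUnit_of_mem_patternGroup (hP : IsPatternOrder P) {u : Matrix (Fin n) (Fin n) F}
    (hu : u ∈ patternGroup F P) : IsUnit u := by
  rw [Matrix.isUnit_iff_isUnit_det, Matrix.det_of_isUpperTriangular]
  · simp [hu.1]
  · intro i j hij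
    exact patternGroup_apply_eq_zero hu (ne_of_gt hij) fun h => lt_asymm (hP.1 _ _ h) hij

variable [Fintype F]

lemma inverse_mem_patternGroup (hP : IsPatternOrder P) {u : Matrix (Fin n) (Fin n) F}
    (hu : u ∈ patternGroup F P) : Ring.inverse u ∈ patternGroup F P := by
  obtain ⟨v, rfl⟩ := isUnit_of_mem_patternGroup hP hu
  rw [Ring.inverse_unit]
  have h : v⁻¹ = v ^ (orderOf v - 1) := by
    rw [inv_eq_iff_mul_eq_one, ← pow_succ', Nat.sub_add_cancel (orderOf_pos v), pow_orderOf_eq_one]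
  rw [h, Units.val_pow_eq_pow_val]
  exact pow_mem_patternGroup hP hu _

omit [Fintype F] in
lemma inverse_mul_patternGroup (hP : IsPatternOrder P) {u : Matrix (Fin n) (Fin n) F}
    (hu : u ∈ patternGroup F P) : Ring.inverse u * u = 1 :=
  Ring.inverse_mul_cancel _ (isUnit_of_mem_patternGroup hP hu)

omit [Fintype F] in
lemma mul_inverse_patternGroup (hP : IsPatternOrder P) {u : Matrix (Fin n) (Fin n) F}
    (hu : u ∈ patternGroup F P) : u * Ring.inverse u = 1 :=
  Ring.mul_inverse_cancel _ (isUnit_of_mem_patternGroup hP hu)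

omit [Fintype F] in
lemma inverse_inverse_patternGroup (hP : IsPatternOrder P) {u : Matrix (Fin n) (Fin n) F}
    (hu : u ∈ patternGroup F P) : Ring.inverse (Ring.inverse u) = u := by
  obtain ⟨v, rfl⟩ := isUnit_of_mem_patternGroup hP hu
  simp

lemma sum_inverse_patternGroup (hP : IsPatternOrder P) (f : Matrix (Fin n) (Fin n) F → ℂ) :
    ∑ x ∈ setFinset (patternGroup F P), f (Ring.inverse x) =
      ∑ x ∈ setFinset (patternGroup F P), f x := by
  refine Finset.sum_nbij' Ring.inverse Ring.inverse ?_ ?_ ?_ ?_ ?_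
  · exact fun x hx => mem_setFinset.2 (inverse_mem_patternGroup hP (mem_setFinset.1 hx))
  · exact fun x hx => mem_setFinset.2 (inverse_mem_patternGroup hP (mem_setFinset.1 hx))
  · exact fun x hx => inverse_inverse_patternGroup hP (mem_setFinset.1 hx)
  · exact fun x hx => inverse_inverse_patternGroup hP (mem_setFinset.1 hx)
  · exact fun x hx => rfl

lemma sum_mul_right_patternGroup (hP : IsPatternOrder P) {y : Matrix (Fin n) (Fin n) F}
    (hy : y ∈ patternGroup F P) (f : Matrix (Fin n) (Fin n) F → ℂ) :
    ∑ x ∈ setFinset (patternGroup F P), f (x * y) =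
      ∑ x ∈ setFinset (patternGroup F P), f x := by
  refine Finset.sum_nbij' (· * y) (· * Ring.inverse y) ?_ ?_ ?_ ?_ ?_
  · exact fun x hx => mem_setFinset.2 (mul_mem_patternGroup hP (mem_setFinset.1 hx) hy)
  · exact fun x hx => mem_setFinset.2
      (mul_mem_patternGroup hP (mem_setFinset.1 hx) (inverse_mem_patternGroup hP hy))
  · exact fun x hx => by simp only [mul_assoc, mul_inverse_patternGroup hP hy, mul_one]
  · exact fun x hx => by simp only [mul_assoc, inverse_mul_patternGroup hP hy, mul_one]
  · exact fun x hx => rfl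

lemma sum_mul_left_patternGroup (hP : IsPatternOrder P) {y : Matrix (Fin n) (Fin n) F}
    (hy : y ∈ patternGroup F P) (f : Matrix (Fin n) (Fin n) F → ℂ) :
    ∑ x ∈ setFinset (patternGroup F P), f (y * x) =
      ∑ x ∈ setFinset (patternGroup F P), f x := by
  refine Finset.sum_nbij' (y * ·) (Ring.inverse y * ·) ?_ ?_ ?_ ?_ ?_
  · exact fun x hx => mem_setFinset.2 (mul_mem_patternGroup hP hy (mem_setFinset.1 hx))
  · exact fun x hx => mem_setFinset.2
      (mul_mem_patternGroup hP (inverse_mem_patternGroup hP hy) (mem_setFinset.1 hx))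
  · exact fun x hx => by simp only [← mul_assoc, inverse_mul_patternGroup hP hy, one_mul]
  · exact fun x hx => by simp only [← mul_assoc, mul_inverse_patternGroup hP hy, one_mul]
  · exact fun x hx => rfl

end PatternGroup

section Average

variable {F : Type*} [Field F] {n : ℕ} {P : Fin n → Fin n → Prop}

/-- The action of `(x, y)` on functionals by `(x · m · y)(N) = m(x N y)`. -/
def coact (P : Fin n → Fin n → Prop) (x y m : Matrix (Fin n) (Fin n) F) :
    Matrix (Fin n) (Fin n) F :=
  dproj P (xᵀ * m * yᵀ)

lemma dproj_apply (m : Matrix (Fin n) (Fin n) F) (i j : Fin n) :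
    dproj P m i j = if P i j then m i j else 0 := rfl

lemma dproj_dproj (m : Matrix (Fin n) (Fin n) F) : dproj P (dproj P m) = dproj P m := by
  ext i j
  by_cases h : P i j <;> simp [dproj_apply, h]

lemma coact_dproj (hP : IsPatternOrder P) {x y : Matrix (Fin n) (Fin n) F}
    (hx : x ∈ patternGroup F P) (hy : y ∈ patternGroup F P) (m : Matrix (Fin n) (Fin n) F) :
    coact P x y (dproj P m) = coact P x y m := by
  ext a b
  rw [coact, coact, dproj_apply, dproj_apply]
  split_ifs with hab
  · simp only [Matrix.mul_apply, Matrix.transpose_apply]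
    refine Finset.sum_congr rfl fun d _ => ?_
    rcases eq_or_ne (y b d) 0 with hbd | hbd
    · simp [hbd]
    congr 1
    refine Finset.sum_congr rfl fun c _ => ?_
    rcases eq_or_ne (x c a) 0 with hca | hca
    · simp [hca]
    have h1 : P c b := by
      rcases eq_or_ne c a with rfl | h
      · exact hab
      · exact hP.2 _ _ _ (hx.2 c a h hca) hab
    have h2 : P c d := by
      rcases eq_or_ne b d with rfl | h
      · exact h1
      · exact hP.2 _ _ _ h1 (hy.2 b d h hbd)
    rw [dproj_apply, if_pos h2]
  · rfl

lemma coact_coact (hP : IsPatternOrder P) {x y x' y' : Matrix (Fin n) (Fin n) F}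
    (hx : x ∈ patternGroup F P) (hy : y ∈ patternGroup F P) (m : Matrix (Fin n) (Fin n) F) :
    coact P x y (coact P x' y' m) = coact P (x' * x) (y * y') m := by
  rw [coact, coact, ← coact, coact_dproj hP hx hy]
  simp only [coact, Matrix.transpose_mul, mul_assoc]

lemma coact_neg (x y m : Matrix (Fin n) (Fin n) F) : coact P x y (-m) = -coact P x y m := by
  ext i j
  by_cases h : P i j <;> simp [coact, dproj_apply, h]

lemma pairF_eq_trace (a b : Matrix (Fin n) (Fin n) F) : pairF a b = (aᵀ * b).trace := by
  simp only [pairF, Matrix.trace, Matrix.diag_apply, Matrix.mul_apply, Matrix.transpose_apply]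
  exact Finset.sum_comm

lemma pairF_dproj (m : Matrix (Fin n) (Fin n) F) {N : Matrix (Fin n) (Fin n) F}
    (hN : ∀ i j, N i j ≠ 0 → P i j) : pairF (dproj P m) N = pairF m N := by
  refine Finset.sum_congr rfl fun i _ => Finset.sum_congr rfl fun j _ => ?_
  rcases eq_or_ne (N i j) 0 with h | h
  · simp [h]
  · rw [dproj_apply, if_pos (hN i j h)]

lemma pairF_coact (x y m : Matrix (Fin n) (Fin n) F) {N : Matrix (Fin n) (Fin n) F}
    (hN : ∀ i j, N i j ≠ 0 → P i j) : pairF (coact P x y m) N = pairF m (x * N * y) := by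
  rw [coact, pairF_dproj _ hN, pairF_eq_trace, pairF_eq_trace]
  simp only [Matrix.transpose_mul, Matrix.transpose_transpose, mul_assoc]
  rw [Matrix.trace_mul_comm]
  simp only [mul_assoc]

lemma pairF_neg (m N : Matrix (Fin n) (Fin n) F) : pairF (-m) N = -pairF m N := by
  simp [pairF]

variable [Fintype F]

lemma mem_biOrbit (hP : IsPatternOrder P) {lam m : Matrix (Fin n) (Fin n) F} :
    m ∈ biOrbit F P lam ↔
      ∃ x ∈ patternGroup F P, ∃ y ∈ patternGroup F P, m = coact P x y lam := by
  constructor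
  · rintro ⟨u, hu, v, hv, rfl⟩
    exact ⟨_, inverse_mem_patternGroup hP hu, _, inverse_mem_patternGroup hP hv, rfl⟩
  · rintro ⟨u, hu, v, hv, rfl⟩
    refine ⟨_, inverse_mem_patternGroup hP hu, _, inverse_mem_patternGroup hP hv, ?_⟩
    rw [biact, inverse_inverse_patternGroup hP hu, inverse_inverse_patternGroup hP hv, coact]

lemma mem_leftOrbit (hP : IsPatternOrder P) {lam m : Matrix (Fin n) (Fin n) F} :
    m ∈ leftOrbit F P lam ↔ ∃ x ∈ patternGroup F P, m = dproj P (xᵀ * lam) := by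
  constructor
  · rintro ⟨u, hu, rfl⟩
    exact ⟨_, inverse_mem_patternGroup hP hu, rfl⟩
  · rintro ⟨u, hu, rfl⟩
    refine ⟨_, inverse_mem_patternGroup hP hu, ?_⟩
    rw [lact, inverse_inverse_patternGroup hP hu]

lemma coact_mem_biOrbit (hP : IsPatternOrder P) {x y lam m : Matrix (Fin n) (Fin n) F}
    (hx : x ∈ patternGroup F P) (hy : y ∈ patternGroup F P) (hm : m ∈ biOrbit F P lam) :
    coact P x y m ∈ biOrbit F P lam := by
  obtain ⟨x', hx', y', hy', rfl⟩ := (mem_biOrbit hP).1 hm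
  rw [coact_coact hP hx hy]
  exact (mem_biOrbit hP).2
    ⟨_, mul_mem_patternGroup hP hx' hx, _, mul_mem_patternGroup hP hy hy', rfl⟩

omit [Fintype F] in
lemma coact_one_of_mem_biOrbit {lam m : Matrix (Fin n) (Fin n) F} (hm : m ∈ biOrbit F P lam) :
    coact P 1 1 m = m := by
  obtain ⟨x, -, y, -, rfl⟩ := hm
  simp [coact, biact, dproj_dproj]

lemma sum_coact_biOrbit (hP : IsPatternOrder P) {x y : Matrix (Fin n) (Fin n) F}
    (hx : x ∈ patternGroup F P) (hy : y ∈ patternGroup F P) (lam : Matrix (Fin n) (Fin n) F)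
    (f : Matrix (Fin n) (Fin n) F → ℂ) :
    ∑ m ∈ setFinset (biOrbit F P lam), f (coact P x y m) =
      ∑ m ∈ setFinset (biOrbit F P lam), f m := by
  have hx' := inverse_mem_patternGroup hP hx
  have hy' := inverse_mem_patternGroup hP hy
  refine Finset.sum_nbij' (coact P x y) (coact P (Ring.inverse x) (Ring.inverse y))
    (fun m hm => mem_setFinset.2 (coact_mem_biOrbit hP hx hy (mem_setFinset.1 hm)))
    (fun m hm => mem_setFinset.2 (coact_mem_biOrbit hP hx' hy' (mem_setFinset.1 hm)))
    (fun m hm => ?_) (fun m hm => ?_) (fun m _ => rfl)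
  · rw [coact_coact hP hx' hy', mul_inverse_patternGroup hP hx, inverse_mul_patternGroup hP hy,
      coact_one_of_mem_biOrbit (mem_setFinset.1 hm)]
  · rw [coact_coact hP hx hy, inverse_mul_patternGroup hP hx, mul_inverse_patternGroup hP hy,
      coact_one_of_mem_biOrbit (mem_setFinset.1 hm)]

lemma expect_biOrbit (hP : IsPatternOrder P) (lam : Matrix (Fin n) (Fin n) F)
    (f : Matrix (Fin n) (Fin n) F → ℂ) :
    𝔼 m ∈ setFinset (biOrbit F P lam), f m =
      𝔼 x ∈ setFinset (patternGroup F P), 𝔼 y ∈ setFinset (patternGroup F P),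
        f (coact P x y lam) := by
  have h1 : 𝔼 x ∈ setFinset (patternGroup F P), 𝔼 y ∈ setFinset (patternGroup F P),
      𝔼 m ∈ setFinset (biOrbit F P lam), f (coact P x y m) =
        𝔼 m ∈ setFinset (biOrbit F P lam), f m := by
    have hne : (setFinset (patternGroup F P)).Nonempty :=
      ⟨1, mem_setFinset.2 one_mem_patternGroup⟩
    rw [← Finset.expect_const hne (𝔼 m ∈ setFinset (biOrbit F P lam), f m)]
    refine Finset.expect_congr rfl fun x hx => ?_
    rw [← Finset.expect_const hne (𝔼 m ∈ setFinset (biOrbit F P lam), f m)]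
    refine Finset.expect_congr rfl fun y hy => ?_
    rw [Finset.expect_eq_sum_div_card, Finset.expect_eq_sum_div_card,
      sum_coact_biOrbit hP (mem_setFinset.1 hx) (mem_setFinset.1 hy)]
  have hne : (setFinset (biOrbit F P lam)).Nonempty :=
    ⟨_, mem_setFinset.2 ((mem_biOrbit hP).2
      ⟨1, one_mem_patternGroup, 1, one_mem_patternGroup, rfl⟩)⟩
  rw [← h1]
  simp_rw [Finset.expect_comm (setFinset (patternGroup F P)) (setFinset (biOrbit F P lam))]
  rw [← Finset.expect_const hne (𝔼 x ∈ setFinset (patternGroup F P),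
    𝔼 y ∈ setFinset (patternGroup F P), f (coact P x y lam))]
  refine Finset.expect_congr rfl fun m hm => ?_
  obtain ⟨x', hx', y', hy', rfl⟩ := (mem_biOrbit hP).1 (mem_setFinset.1 hm)
  have h2 : ∀ x ∈ setFinset (patternGroup F P),
      𝔼 y ∈ setFinset (patternGroup F P), f (coact P x y (coact P x' y' lam)) =
        𝔼 y ∈ setFinset (patternGroup F P), f (coact P (x' * x) y lam) := by
    intro x hx
    rw [Finset.expect_eq_sum_div_card, Finset.expect_eq_sum_div_card,
      ← sum_mul_right_patternGroup hP hy' (fun y => f (coact P (x' * x) y lam))]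
    congr 1
    exact Finset.sum_congr rfl fun y hy => by
      rw [coact_coact hP (mem_setFinset.1 hx) (mem_setFinset.1 hy)]
  rw [Finset.expect_congr rfl h2, Finset.expect_eq_sum_div_card, Finset.expect_eq_sum_div_card,
    sum_mul_left_patternGroup hP hx'
      (fun x => 𝔼 y ∈ setFinset (patternGroup F P), f (coact P x y lam))]

lemma card_biOrbit_neg (hP : IsPatternOrder P) (lam : Matrix (Fin n) (Fin n) F) :
    (setFinset (biOrbit F P (-lam))).card = (setFinset (biOrbit F P lam)).card := by
  have key : ∀ lam m : Matrix (Fin n) (Fin n) F,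
      m ∈ biOrbit F P lam → -m ∈ biOrbit F P (-lam) := by
    intro lam m hm
    obtain ⟨x, hx, y, hy, rfl⟩ := (mem_biOrbit hP).1 hm
    exact (mem_biOrbit hP).2 ⟨x, hx, y, hy, (coact_neg _ _ _).symm⟩
  refine Finset.card_nbij' (fun m => -m) (fun m => -m) ?_ ?_ ?_ ?_
  · intro m hm
    simpa [mem_setFinset] using key _ _ (mem_setFinset.1 hm)
  · intro m hm
    simpa [mem_setFinset] using key _ _ (mem_setFinset.1 hm)
  · intro m _
    simp
  · intro m _
    simp

lemma superchar_eq_expect (hP : IsPatternOrder P) (θ : F → ℂ) (lam : Matrix (Fin n) (Fin n) F)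
    {g : Matrix (Fin n) (Fin n) F} (hg : g ∈ patternGroup F P) :
    superchar P θ lam g = (setFinset (leftOrbit F P lam)).card *
      𝔼 x ∈ setFinset (patternGroup F P), 𝔼 y ∈ setFinset (patternGroup F P),
        θ (-pairF lam (x * (g - 1) * y)) := by
  have h := expect_biOrbit hP (-lam) (fun m => θ (pairF m (g - 1)))
  simp only [pairF_coact _ _ _ fun i j => sub_one_apply_ne_zero hg, pairF_neg] at h
  rw [superchar, ← h, Finset.expect_eq_sum_div_card, card_biOrbit_neg hP]
  ring

end Average

section Factorization

variable {F : Type*} [Field F] [Fintype F] {n : ℕ} {P : Fin n → Fin n → Prop}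

/-- The possible `i`-th rows of elements of the pattern group. -/
def rowSet (F : Type*) [Field F] [Fintype F] {n : ℕ} (P : Fin n → Fin n → Prop) (i : Fin n) :
    Finset (Fin n → F) :=
  Finset.univ.filter fun r => r i = 1 ∧ ∀ a, i ≠ a → r a ≠ 0 → P i a

/-- The possible `l`-th columns of elements of the pattern group. -/
def colSet (F : Type*) [Field F] [Fintype F] {n : ℕ} (P : Fin n → Fin n → Prop) (l : Fin n) :
    Finset (Fin n → F) :=
  Finset.univ.filter fun c => c l = 1 ∧ ∀ b, b ≠ l → c b ≠ 0 → P b l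

lemma mem_rowSet {i : Fin n} {r : Fin n → F} :
    r ∈ rowSet F P i ↔ r i = 1 ∧ ∀ a, i ≠ a → r a ≠ 0 → P i a := by
  simp [rowSet]

lemma mem_colSet {l : Fin n} {c : Fin n → F} :
    c ∈ colSet F P l ↔ c l = 1 ∧ ∀ b, b ≠ l → c b ≠ 0 → P b l := by
  simp [colSet]

lemma rowSet_nonempty (i : Fin n) : (rowSet F P i).Nonempty :=
  ⟨Pi.single i 1, mem_rowSet.2 ⟨Pi.single_eq_same i 1,
    fun _ ha h => absurd (Pi.single_eq_of_ne' ha 1) h⟩⟩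

lemma colSet_nonempty (l : Fin n) : (colSet F P l).Nonempty :=
  ⟨Pi.single l 1, mem_colSet.2 ⟨Pi.single_eq_same l 1,
    fun _ hb h => absurd (Pi.single_eq_of_ne hb 1) h⟩⟩

lemma sum_patternGroup_rows (f : Matrix (Fin n) (Fin n) F → ℂ) :
    ∑ x ∈ setFinset (patternGroup F P), f x =
      ∑ x ∈ Fintype.piFinset (rowSet F P), f (Matrix.of x) := by
  refine Finset.sum_nbij' Matrix.of.symm Matrix.of ?_ ?_ (fun _ _ => rfl) (fun _ _ => rfl)
    (fun _ _ => rfl)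
  · intro x hx
    have hx := mem_setFinset.1 hx
    exact Fintype.mem_piFinset.2 fun i => mem_rowSet.2 ⟨hx.1 i, hx.2 i⟩
  · intro x hx
    have hx := fun i => mem_rowSet.1 (Fintype.mem_piFinset.1 hx i)
    exact mem_setFinset.2 ⟨fun i => (hx i).1, fun i => (hx i).2⟩

lemma sum_patternGroup_cols (f : Matrix (Fin n) (Fin n) F → ℂ) :
    ∑ y ∈ setFinset (patternGroup F P), f y =
      ∑ z ∈ Fintype.piFinset (colSet F P), f (Matrix.of z)ᵀ := by
  refine Finset.sum_nbij' (fun y => Matrix.of.symm yᵀ) (fun z => (Matrix.of z)ᵀ) ?_ ?_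
    (fun _ _ => rfl) (fun _ _ => rfl) (fun _ _ => rfl)
  · intro x hx
    have hx := mem_setFinset.1 hx
    exact Fintype.mem_piFinset.2 fun i => mem_colSet.2 ⟨hx.1 i, fun b hb => hx.2 b i hb⟩
  · intro x hx
    have hx := fun i => mem_colSet.1 (Fintype.mem_piFinset.1 hx i)
    exact mem_setFinset.2 ⟨fun i => (hx i).1, fun b i hb => (hx i).2 b hb⟩

lemma card_patternGroup_rows :
    (setFinset (patternGroup F P)).card = (Fintype.piFinset (rowSet F P)).card := by
  have h := sum_patternGroup_rows (F := F) (P := P) fun _ => 1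
  simp only [Finset.sum_const, nsmul_eq_mul, mul_one] at h
  exact_mod_cast h

lemma card_patternGroup_cols :
    (setFinset (patternGroup F P)).card = (Fintype.piFinset (colSet F P)).card := by
  have h := sum_patternGroup_cols (F := F) (P := P) fun _ => 1
  simp only [Finset.sum_const, nsmul_eq_mul, mul_one] at h
  exact_mod_cast h

lemma expect_patternGroup_rows (f : Matrix (Fin n) (Fin n) F → ℂ) :
    𝔼 x ∈ setFinset (patternGroup F P), f x =
      𝔼 x ∈ Fintype.piFinset (rowSet F P), f (Matrix.of x) := by
  rw [Finset.expect_eq_sum_div_card, Finset.expect_eq_sum_div_card, sum_patternGroup_rows,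
    card_patternGroup_rows]

lemma expect_patternGroup_cols (f : Matrix (Fin n) (Fin n) F → ℂ) :
    𝔼 y ∈ setFinset (patternGroup F P), f y =
      𝔼 z ∈ Fintype.piFinset (colSet F P), f (Matrix.of z)ᵀ := by
  rw [Finset.expect_eq_sum_div_card, Finset.expect_eq_sum_div_card, sum_patternGroup_cols,
    card_patternGroup_cols]

lemma expect_piFinset {ι α : Type*} [Fintype ι] [DecidableEq ι] (S : ι → Finset α) (f : ι → α → ℂ) :
    𝔼 x ∈ Fintype.piFinset S, ∏ i, f i (x i) = ∏ i, 𝔼 a ∈ S i, f i a := by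
  simp only [Finset.expect_eq_sum_div_card, Finset.prod_div_distrib, Finset.prod_univ_sum,
    Fintype.card_piFinset, Nat.cast_prod]

/-- The average of a product is the product of the averages if at most one factor is not
identically one. -/
lemma expect_prod_of_subsingleton {ι α : Type*} [Fintype ι] {S : Finset α} (hS : S.Nonempty)
    (f : ι → α → ℂ) (p : ι → Prop) (hp : ∀ i j, p i → p j → i = j)
    (hf : ∀ i, ¬ p i → ∀ a, f i a = 1) :
    𝔼 a ∈ S, ∏ i, f i a = ∏ i, 𝔼 a ∈ S, f i a := by
  have hE : ∀ i, ¬ p i → 𝔼 a ∈ S, f i a = 1 := fun i hi => by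
    simp only [hf i hi, Finset.expect_const hS]
  by_cases h : ∃ i, p i
  · obtain ⟨i, hi⟩ := h
    have hne : ∀ j, j ≠ i → ¬ p j := fun j hj hpj => hj (hp _ _ hpj hi)
    rw [Finset.prod_eq_single i (fun j _ hj => hE j (hne j hj)) (by simp)]
    refine Finset.expect_congr rfl fun a _ => ?_
    rw [Finset.prod_eq_single i (fun j _ hj => hf j (hne j hj) a) (by simp)]
  · push Not at h
    rw [Finset.prod_eq_one fun i _ => hE i (h i), ← Finset.expect_const hS (1 : ℂ)]
    exact Finset.expect_congr rfl fun a _ => Finset.prod_eq_one fun i _ => hf i (h i) a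

lemma expect_expect_piFinset {ι κ α β : Type*} [Fintype ι] [DecidableEq ι] [Fintype κ]
    [DecidableEq κ] (R : ι → Finset α) (C : κ → Finset β) (hR : ∀ i, (R i).Nonempty)
    (hC : ∀ l, (C l).Nonempty)
    (f : ι → κ → α → β → ℂ) (p : ι → κ → Prop)
    (hrow : ∀ i l l', p i l → p i l' → l = l') (hcol : ∀ i i' l, p i l → p i' l → i = i')
    (hf : ∀ i l, ¬ p i l → ∀ a b, f i l a b = 1) :
    𝔼 x ∈ Fintype.piFinset R, 𝔼 z ∈ Fintype.piFinset C, ∏ i, ∏ l, f i l (x i) (z l) =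
      ∏ i, ∏ l, 𝔼 a ∈ R i, 𝔼 b ∈ C l, f i l a b := by
  have h1 : ∀ x : ι → α, 𝔼 z ∈ Fintype.piFinset C, ∏ i, ∏ l, f i l (x i) (z l) =
      ∏ i, ∏ l, 𝔼 b ∈ C l, f i l (x i) b := by
    intro x
    simp_rw [Finset.prod_comm (s := (Finset.univ : Finset ι))]
    rw [expect_piFinset C fun l b => ∏ i, f i l (x i) b]
    exact Finset.prod_congr rfl fun l _ => expect_prod_of_subsingleton (hC l) _ (fun i => p i l)
      (fun i j => hcol i j l) fun i hi b => hf i l hi _ b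
  simp_rw [h1]
  rw [expect_piFinset R fun i a => ∏ l, 𝔼 b ∈ C l, f i l a b]
  refine Finset.prod_congr rfl fun i _ => expect_prod_of_subsingleton (hR i) _ (p i) (hrow i)
    fun l hl a => ?_
  simp only [hf i l hl, Finset.expect_const (hC l)]

lemma card_leftOrbit (hP : IsPatternOrder P) {lam : Matrix (Fin n) (Fin n) F}
    (hsupp : ∀ i l, lam i l ≠ 0 → P i l)
    (hrow : ∀ i l l', lam i l ≠ 0 → lam i l' ≠ 0 → l = l')
    (hcol : ∀ i i' l, lam i l ≠ 0 → lam i' l ≠ 0 → i = i') :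
    (setFinset (leftOrbit F P lam)).card = ∏ i, ∏ l, if lam i l = 0 then 1 else
      Fintype.card F ^ (Finset.univ.filter fun a => P i a ∧ P a l).card := by
  let S : Fin n → Fin n → Finset F := fun a l =>
    if ∃ i, P i a ∧ P a l ∧ lam i l ≠ 0 then Finset.univ else {lam a l}
  have hmem : ∀ m : Matrix (Fin n) (Fin n) F,
      m ∈ leftOrbit F P lam ↔ ∀ a l, m a l ∈ S a l := by
    have fixed : ∀ x ∈ patternGroup F P, ∀ a l, (¬ ∃ i, P i a ∧ P a l ∧ lam i l ≠ 0) →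
        dproj P (xᵀ * lam) a l = lam a l := by
      intro x hx a l h
      push Not at h
      rw [dproj_apply]
      split_ifs with hal
      · rw [Matrix.mul_apply, Finset.sum_eq_single a]
        · simp [hx.1 a]
        · intro i _ hia
          by_cases hi : P i a
          · rw [h i hi hal, mul_zero]
          · rw [Matrix.transpose_apply, patternGroup_apply_eq_zero hx hia hi, zero_mul]
        · simp
      · by_contra h0
        exact hal (hsupp a l (Ne.symm h0))
    intro m
    rw [mem_leftOrbit hP]
    constructor
    · rintro ⟨x, hx, rfl⟩ a l
      by_cases h : ∃ i, P i a ∧ P a l ∧ lam i l ≠ 0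
      · simp [S, if_pos h]
      · simp only [S, if_neg h, Finset.mem_singleton]
        exact fixed x hx a l h
    · intro hm
      let x : Matrix (Fin n) (Fin n) F := fun i a => if i = a then 1 else
        if P i a then ∑ l, if lam i l ≠ 0 then m a l / lam i l else 0 else 0
      have hx : x ∈ patternGroup F P := by
        refine ⟨fun i => by simp [x], fun i a hia h => ?_⟩
        by_contra h'
        exact h (by simp [x, hia, h'])
      refine ⟨x, hx, ?_⟩
      ext a l
      by_cases h : ∃ i, P i a ∧ P a l ∧ lam i l ≠ 0
      · obtain ⟨i, hia, hal, hil⟩ := h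
        rw [dproj_apply, if_pos hal, Matrix.mul_apply, Finset.sum_eq_single i,
          Matrix.transpose_apply]
        · have : x i a = m a l / lam i l := by
            simp only [x]
            rw [if_neg (hP.1 _ _ hia).ne, if_pos hia, Finset.sum_eq_single l, if_pos hil]
            · intro l' _ hl'
              rw [if_neg]
              exact fun h' => hl' (hrow _ _ _ h' hil)
            · simp
          rw [this, div_mul_cancel₀ _ hil]
        · intro i' _ hi'
          have : lam i' l = 0 := by
            by_contra h'
            exact hi' (hcol _ _ _ h' hil)
          rw [this, mul_zero]
        · simp
      · rw [fixed x hx a l h]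
        have := hm a l
        simpa only [S, if_neg h, Finset.mem_singleton] using this
  have hcard : (setFinset (leftOrbit F P lam)).card =
      (Fintype.piFinset fun a => Fintype.piFinset fun l => S a l).card := by
    refine Finset.card_nbij' Matrix.of.symm Matrix.of ?_ ?_ (fun _ _ => rfl) (fun _ _ => rfl)
    · intro m hm
      have hm := (hmem m).1 (mem_setFinset.1 hm)
      exact Fintype.mem_piFinset.2 fun a => Fintype.mem_piFinset.2 fun l => hm a l
    · intro m hm
      refine mem_setFinset.2 ((hmem _).2 fun a l => ?_)
      exact Fintype.mem_piFinset.1 (Fintype.mem_piFinset.1 hm a) l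
  rw [hcard]
  simp only [Fintype.card_piFinset]
  rw [Finset.prod_comm, Finset.prod_comm (f := fun i l => if lam i l = 0 then 1 else
      Fintype.card F ^ (Finset.univ.filter fun a => P i a ∧ P a l).card)]
  refine Finset.prod_congr rfl fun l _ => ?_
  have h1 : ∀ i, (if lam i l = 0 then 1 else
      Fintype.card F ^ (Finset.univ.filter fun a => P i a ∧ P a l).card) =
        ∏ a, if P i a ∧ P a l ∧ lam i l ≠ 0 then Fintype.card F else 1 := by
    intro i
    by_cases h : lam i l = 0
    · simp [h]
    · rw [if_neg h, ← Finset.prod_const, Finset.prod_filter]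
      simp [h]
  simp_rw [h1]
  rw [Finset.prod_comm]
  refine Finset.prod_congr rfl fun a _ => ?_
  by_cases h : ∃ i, P i a ∧ P a l ∧ lam i l ≠ 0
  · simp only [S, if_pos h]
    obtain ⟨i, hi⟩ := h
    rw [Finset.prod_eq_single i, if_pos hi, Finset.card_univ]
    · intro j _ hj
      rw [if_neg]
      exact fun h' => hj (hcol _ _ _ h'.2.2 hi.2.2)
    · simp
  · simp only [S, if_neg h, Finset.card_singleton]
    push Not at h
    refine (Finset.prod_eq_one fun i _ => if_neg ?_).symm
    exact fun h' => h'.2.2 (h i h'.1 h'.2.1)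

/-- The supercharacter of a single arc `i ⌢_t l`, as a function of `N = g - 1`; it is constantly
one for `t = 0`. -/
def arcChar (P : Fin n → Fin n → Prop) (θ : AddChar F ℂ) (N : Matrix (Fin n) (Fin n) F)
    (i l : Fin n) (t : F) : ℂ :=
  (if t = 0 then 1 else
      (Fintype.card F : ℂ) ^ (Finset.univ.filter fun a => P i a ∧ P a l).card) *
    𝔼 r ∈ rowSet F P i, 𝔼 c ∈ colSet F P l, θ (-(t * (r ⬝ᵥ N *ᵥ c)))

lemma arcChar_zero (θ : AddChar F ℂ) (N : Matrix (Fin n) (Fin n) F) (i l : Fin n) :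
    arcChar P θ N i l 0 = 1 := by
  simp [arcChar, Finset.expect_const (rowSet_nonempty i), Finset.expect_const (colSet_nonempty l)]

lemma superchar_eq_prod (hP : IsPatternOrder P) (θ : AddChar F ℂ)
    {lam : Matrix (Fin n) (Fin n) F} (hsupp : ∀ i l, lam i l ≠ 0 → P i l)
    (hrow : ∀ i l l', lam i l ≠ 0 → lam i l' ≠ 0 → l = l')
    (hcol : ∀ i i' l, lam i l ≠ 0 → lam i' l ≠ 0 → i = i')
    {g : Matrix (Fin n) (Fin n) F} (hg : g ∈ patternGroup F P) :
    superchar P θ lam g = ∏ i, ∏ l, arcChar P θ (g - 1) i l (lam i l) := by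
  have hθ : ∀ f : Fin n → F, θ (∑ i, f i) = ∏ i, θ (f i) := fun f =>
    map_prod θ.toMonoidHom (fun i => Multiplicative.ofAdd (f i)) Finset.univ
  obtain ⟨φ, hφ⟩ : ∃ φ : Fin n → Fin n → (Fin n → F) → (Fin n → F) → ℂ,
      ∀ i l r c, φ i l r c = θ (-(lam i l * (r ⬝ᵥ (g - 1) *ᵥ c))) := ⟨_, fun _ _ _ _ => rfl⟩
  have hpair : ∀ x z : Fin n → Fin n → F,
      θ (-pairF lam (Matrix.of x * (g - 1) * (Matrix.of z)ᵀ)) =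
        ∏ i, ∏ l, φ i l (x i) (z l) := by
    intro x z
    have : ∀ i l, (Matrix.of x * (g - 1) * (Matrix.of z)ᵀ) i l = x i ⬝ᵥ (g - 1) *ᵥ z l :=
      fun i l => by rw [mul_assoc]; rfl
    simp only [pairF, this, ← Finset.sum_neg_distrib, hθ, hφ]
  rw [superchar_eq_expect hP θ lam hg, card_leftOrbit hP hsupp hrow hcol,
    expect_patternGroup_rows]
  simp_rw [expect_patternGroup_cols, hpair]
  rw [expect_expect_piFinset (rowSet F P) (colSet F P) rowSet_nonempty colSet_nonempty φ
    (fun i l => lam i l ≠ 0) hrow hcol (fun i l h a b => by simp [hφ, not_not.1 h])]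
  push_cast
  simp only [← Finset.prod_mul_distrib, arcChar, hφ]

end Factorization

section ArcIdentities

variable {F : Type*} [Field F] [Fintype F] {n : ℕ}

lemma expect_eq_zero_of_shift {V : Type*} [AddGroup V] {S : Finset V} (v : V)
    (hS : ∀ r, r + v ∈ S ↔ r ∈ S) {f : V → ℂ} {k : ℂ} (hk : k ≠ 1)
    (hf : ∀ r, f (r + v) = k * f r) : 𝔼 r ∈ S, f r = 0 := by
  have h : 𝔼 r ∈ S, f r = k * 𝔼 r ∈ S, f r := by
    rw [Finset.mul_expect]
    refine Finset.expect_nbij' (fun r => r - v) (fun r => r + v) ?_ ?_ ?_ ?_ ?_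
    · intro r hr
      rw [← hS]
      simpa using hr
    · exact fun r hr => (hS r).2 hr
    · simp
    · simp
    · intro r _
      rw [← hf, sub_add_cancel]
  have h' : (1 - k) * 𝔼 r ∈ S, f r = 0 := by linear_combination h
  exact (mul_eq_zero.1 h').resolve_left (sub_ne_zero.2 hk.symm)

omit [Field F] in
lemma sum_eq_sum_update {S S' : Finset (Fin n → F)} (b : Fin n) (v : F)
    (hS : ∀ c, c ∈ S' ↔ Function.update c b v ∈ S) (hb : ∀ c ∈ S, c b = v)
    (f : (Fin n → F) → ℂ) :
    ∑ c ∈ S', f c = ∑ s : F, ∑ c ∈ S, f (Function.update c b s) := by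
  rw [← Finset.sum_product']
  refine Finset.sum_nbij' (fun c => (c b, Function.update c b v))
    (fun p => Function.update p.2 b p.1) ?_ ?_ ?_ ?_ ?_
  · intro c hc
    simpa using (hS c).1 hc
  · rintro ⟨s, c⟩ hc
    have hc := (Finset.mem_product.1 hc).2
    rw [hS]
    simpa [← hb c hc] using hc
  · intro c _
    simp
  · rintro ⟨s, c⟩ hc
    have hc := (Finset.mem_product.1 hc).2
    simp [← hb c hc]
  · intro c _
    simp

omit [Field F] in
lemma card_eq_card_mul_of_update {S S' : Finset (Fin n → F)} (b : Fin n) (v : F)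
    (hS : ∀ c, c ∈ S' ↔ Function.update c b v ∈ S) (hb : ∀ c ∈ S, c b = v) :
    (S'.card : ℂ) = Fintype.card F * S.card := by
  simpa using sum_eq_sum_update b v hS hb fun _ => 1

omit [Field F] in
lemma expect_eq_expect_update {S S' : Finset (Fin n → F)} (b : Fin n) (v : F)
    (hS : ∀ c, c ∈ S' ↔ Function.update c b v ∈ S) (hb : ∀ c ∈ S, c b = v)
    (f : (Fin n → F) → ℂ) :
    𝔼 c ∈ S', f c = 𝔼 s : F, 𝔼 c ∈ S, f (Function.update c b s) := by
  simp only [Finset.expect_eq_sum_div_card]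
  rw [sum_eq_sum_update b v hS hb, card_eq_card_mul_of_update b v hS hb, ← Finset.sum_div,
    div_div, mul_comm, Finset.card_univ]

/-- The vectors supported on the first `m` coordinates. -/
def lowSet (F : Type*) [Field F] [Fintype F] (n m : ℕ) : Finset (Fin n → F) :=
  Finset.univ.filter fun c => ∀ b : Fin n, m ≤ (b : ℕ) → c b = 0

lemma mem_lowSet {m : ℕ} {c : Fin n → F} :
    c ∈ lowSet F n m ↔ ∀ b : Fin n, m ≤ (b : ℕ) → c b = 0 := by
  simp [lowSet]

lemma lowSet_nonempty (m : ℕ) : (lowSet F n m).Nonempty :=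
  ⟨0, mem_lowSet.2 fun _ _ => rfl⟩

lemma expect_lowSet_smul (m : ℕ) {k : F} (hk : k ≠ 0) (f : (Fin n → F) → ℂ) :
    𝔼 c ∈ lowSet F n m, f (k • c) = 𝔼 c ∈ lowSet F n m, f c := by
  refine Finset.expect_nbij' (fun c => k • c) (fun c => k⁻¹ • c) ?_ ?_ ?_ ?_ ?_
  · exact fun c hc => mem_lowSet.2 fun b hb => by simp [mem_lowSet.1 hc b hb]
  · exact fun c hc => mem_lowSet.2 fun b hb => by simp [mem_lowSet.1 hc b hb]
  · exact fun c _ => inv_smul_smul₀ hk c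
  · exact fun c _ => smul_inv_smul₀ hk c
  · exact fun c _ => rfl

lemma expect_lowSet_add {m : ℕ} {d : Fin n → F} (hd : d ∈ lowSet F n m)
    (f : (Fin n → F) → ℂ) :
    𝔼 c ∈ lowSet F n m, f (c + d) = 𝔼 c ∈ lowSet F n m, f c := by
  refine Finset.expect_nbij' (fun c => c + d) (fun c => c - d) ?_ ?_ ?_ ?_ ?_
  · exact fun c hc => mem_lowSet.2 fun b hb => by
      simp [mem_lowSet.1 hc b hb, mem_lowSet.1 hd b hb]
  · exact fun c hc => mem_lowSet.2 fun b hb => by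
      simp [mem_lowSet.1 hc b hb, mem_lowSet.1 hd b hb]
  · exact fun c _ => add_sub_cancel_right c d
  · exact fun c _ => sub_add_cancel c d
  · exact fun c _ => rfl

lemma expect_lowSet_succ (l : Fin n) (f : (Fin n → F) → ℂ) :
    𝔼 c ∈ lowSet F n (l + 1), f c = 𝔼 s : F, 𝔼 c ∈ lowSet F n l, f (c + Pi.single l s) := by
  rw [expect_eq_expect_update (S := lowSet F n l) l 0]
  · refine Finset.expect_congr rfl fun s _ => Finset.expect_congr rfl fun c hc => ?_
    congr 1
    ext b
    rcases eq_or_ne b l with rfl | hb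
    · simp [mem_lowSet.1 hc b le_rfl]
    · simp [hb]
  · intro c
    rw [mem_lowSet, mem_lowSet]
    refine forall_congr' fun b => ?_
    rcases eq_or_ne b l with rfl | hb
    · simp
    · have : (b : ℕ) ≠ l := fun h => hb (Fin.ext h)
      rw [Function.update_of_ne hb]
      exact ⟨fun h h' => h (by omega), fun h h' => h (by omega)⟩
  · exact fun c hc => mem_lowSet.1 hc l le_rfl

/-- The character `1 + ∑_{j < k < m} ∑_{t ≠ 0} χ^{j ⌢_t k}` as a function of `N = g - 1`. -/
def freeRowChar (θ : AddChar F ℂ) (N : Matrix (Fin n) (Fin n) F) (j : Fin n) (m : ℕ) : ℂ :=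
  (Fintype.card F : ℂ) ^ (m - 1 - j) *
    𝔼 r ∈ rowSet F (fun i j : Fin n => i < j) j, 𝔼 c ∈ lowSet F n m, θ (r ⬝ᵥ N *ᵥ c)

lemma rowSet_apply_eq_zero {j : Fin n} {r : Fin n → F}
    (hr : r ∈ rowSet F (fun i j : Fin n => i < j) j) {a : Fin n} (ha : a < j) : r a = 0 := by
  by_contra h
  exact lt_asymm ha ((mem_rowSet.1 hr).2 a ha.ne' h)

lemma expect_rowSet_eq_zero {θ : AddChar F ℂ} (hθ : ∃ a, θ a ≠ 1) {i b : Fin n} (hib : i < b)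
    {w : Fin n → F} (hw : w b ≠ 0) {t : F} (ht : t ≠ 0) :
    𝔼 r ∈ rowSet F (fun i j : Fin n => i < j) i, θ (-(t * (r ⬝ᵥ w))) = 0 := by
  obtain ⟨s, hs⟩ := hθ
  refine expect_eq_zero_of_shift (Pi.single b (-s / (t * w b))) ?_ hs ?_
  · intro r
    rw [mem_rowSet, mem_rowSet, Pi.add_apply, Pi.single_eq_of_ne hib.ne, add_zero]
    refine and_congr_right fun _ => forall_congr' fun a => forall_congr' fun _ => ?_
    rcases eq_or_ne a b with rfl | hab
    · simp [hib]
    · simp [hab]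
  · intro r
    rw [← AddChar.map_add_eq_mul, add_dotProduct, single_dotProduct]
    congr 1
    field_simp
    ring

lemma arcChar_eq_lowSet (θ : AddChar F ℂ) (N : Matrix (Fin n) (Fin n) F) {j l : Fin n} {t : F}
    (ht : t ≠ 0) : arcChar (fun i j : Fin n => i < j) θ N j l t =
      (Fintype.card F : ℂ) ^ ((l : ℕ) - 1 - j) *
        𝔼 r ∈ rowSet F (fun i j : Fin n => i < j) j, 𝔼 c ∈ lowSet F n l,
          θ (-(t * (r ⬝ᵥ N *ᵥ (c + Pi.single l 1)))) := by
  have hcard : ∀ S : Finset (Fin n), (∀ a, a ∈ S ↔ j < a ∧ a < l) → S.card = (l : ℕ) - 1 - j := by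
    intro S hS
    have : S = Finset.Ioo j l := by
      ext a
      simp [hS]
    rw [this, Fin.card_Ioo]
    omega
  rw [arcChar, if_neg ht, hcard _ (by simp)]
  congr 1
  refine Finset.expect_congr rfl fun r _ => ?_
  refine Finset.expect_nbij' (fun c => c - Pi.single l 1) (fun c => c + Pi.single l 1)
    ?_ ?_ ?_ ?_ ?_
  · intro c hc
    obtain ⟨h1, h2⟩ := mem_colSet.1 hc
    refine mem_lowSet.2 fun b hb => ?_
    rcases eq_or_ne b l with rfl | hbl
    · simp [h1]
    · have : c b = 0 := by
        by_contra h
        exact absurd (Fin.lt_def.1 (h2 b hbl h)) (by omega)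
      simp [this, hbl]
  · intro c hc
    have hc := mem_lowSet.1 hc
    refine mem_colSet.2 ⟨by simp [hc l le_rfl], fun b hbl h => ?_⟩
    by_contra h'
    exact h (by simp [hbl, hc b (not_lt.1 h')])
  · intro c _
    simp
  · intro c _
    simp
  · intro c _
    simp

lemma arcChar_eq_lowSet_single (θ : AddChar F ℂ) (N : Matrix (Fin n) (Fin n) F) {j l : Fin n}
    {t : F} (ht : t ≠ 0) : arcChar (fun i j : Fin n => i < j) θ N j l t =
      (Fintype.card F : ℂ) ^ ((l : ℕ) - 1 - j) *
        𝔼 r ∈ rowSet F (fun i j : Fin n => i < j) j, 𝔼 c ∈ lowSet F n l,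
          θ (r ⬝ᵥ N *ᵥ (c + Pi.single l (-t))) := by
  rw [arcChar_eq_lowSet θ N ht]
  congr 1
  refine Finset.expect_congr rfl fun r _ => ?_
  refine Eq.trans ?_ (expect_lowSet_smul (l : ℕ) (neg_ne_zero.2 ht) _)
  refine Finset.expect_congr rfl fun c _ => ?_
  have : (-t) • c + Pi.single l (-t) = (-t) • (c + Pi.single l 1) := by
    rw [smul_add, ← Pi.single_smul, smul_eq_mul, mul_one]
  rw [this, mulVec_smul, dotProduct_smul, smul_eq_mul, neg_mul]

lemma freeRowChar_self (θ : AddChar F ℂ) {N : Matrix (Fin n) (Fin n) F}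
    (hN : ∀ i j, N i j ≠ 0 → i < j) (j : Fin n) : freeRowChar θ N j (j + 1) = 1 := by
  have h : ∀ r ∈ rowSet F (fun i j : Fin n => i < j) j, ∀ c ∈ lowSet F n (j + 1),
      θ (r ⬝ᵥ N *ᵥ c) = 1 := by
    intro r hr c hc
    have : r ⬝ᵥ N *ᵥ c = 0 := by
      refine Finset.sum_eq_zero fun a _ => ?_
      rcases lt_or_ge a j with ha | ha
      · rw [rowSet_apply_eq_zero hr ha, zero_mul]
      · rw [mulVec, dotProduct, Finset.sum_eq_zero, mul_zero]
        intro b _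
        by_cases hab : N a b = 0
        · rw [hab, zero_mul]
        · have := Fin.lt_def.1 (hN a b hab)
          have := Fin.le_def.1 ha
          rw [mem_lowSet.1 hc b (by omega), mul_zero]
    rw [this, AddChar.map_zero_eq_one]
  rw [freeRowChar, Finset.expect_congr rfl fun r hr => Finset.expect_congr rfl (h r hr)]
  simp [Finset.expect_const (lowSet_nonempty _), Finset.expect_const (rowSet_nonempty _)]

lemma freeRowChar_succ (θ : AddChar F ℂ) (N : Matrix (Fin n) (Fin n) F) {j l : Fin n}
    (hjl : j < l) : freeRowChar θ N j (l + 1) = freeRowChar θ N j l +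
      ∑ t ∈ Finset.univ.filter (fun t : F => t ≠ 0),
        arcChar (fun i j : Fin n => i < j) θ N j l t := by
  have hq : (Fintype.card F : ℂ) ≠ 0 := Nat.cast_ne_zero.2 Fintype.card_ne_zero
  obtain ⟨G, hG⟩ : ∃ G : F → ℂ, ∀ s, G s = 𝔼 r ∈ rowSet F (fun i j : Fin n => i < j) j,
      𝔼 c ∈ lowSet F n l, θ (r ⬝ᵥ N *ᵥ (c + Pi.single l s)) := ⟨_, fun _ => rfl⟩
  have hexp : (l : ℕ) + 1 - 1 - j = ((l : ℕ) - 1 - j) + 1 := by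
    have := Fin.lt_def.1 hjl
    omega
  have h1 : freeRowChar θ N j (l + 1) =
      (Fintype.card F : ℂ) ^ ((l : ℕ) - 1 - j) * ∑ s, G s := by
    simp_rw [freeRowChar, expect_lowSet_succ l]
    rw [Finset.expect_comm]
    simp_rw [← hG]
    rw [Finset.expect_eq_sum_div_card, hexp, Finset.card_univ, pow_succ]
    field_simp
  have h2 : freeRowChar θ N j l = (Fintype.card F : ℂ) ^ ((l : ℕ) - 1 - j) * G 0 := by
    simp [freeRowChar, hG]
  have h3 : ∑ t ∈ Finset.univ.filter (fun t : F => t ≠ 0),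
      arcChar (fun i j : Fin n => i < j) θ N j l t =
        (Fintype.card F : ℂ) ^ ((l : ℕ) - 1 - j) *
          ∑ t ∈ Finset.univ.filter (fun t : F => t ≠ 0), G t := by
    rw [Finset.mul_sum]
    refine Finset.sum_nbij' (fun t => -t) (fun t => -t) (by simp) (by simp) (by simp) (by simp) ?_
    intro t ht
    rw [arcChar_eq_lowSet_single θ N (Finset.mem_filter.1 ht).2, hG]
  rw [h1, h2, h3, ← mul_add]
  congr 1
  rw [Finset.filter_ne', Finset.add_sum_erase _ _ (Finset.mem_univ _)]

lemma arcChar_mul_arcChar {θ : AddChar F ℂ} (hθ : ∃ a, θ a ≠ 1) (N : Matrix (Fin n) (Fin n) F)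
    {i j l : Fin n} (hij : i < j) {s t : F} (hs : s ≠ 0) (ht : t ≠ 0) :
    arcChar (fun i j : Fin n => i < j) θ N i l s * arcChar (fun i j : Fin n => i < j) θ N j l t =
      arcChar (fun i j : Fin n => i < j) θ N i l s * freeRowChar θ N j l := by
  by_cases h0 : arcChar (fun i j : Fin n => i < j) θ N i l s = 0
  · rw [h0, zero_mul, zero_mul]
  congr 1
  obtain ⟨d, hd, hNd⟩ : ∃ d ∈ lowSet F n l, ∀ b, i < b → (N *ᵥ (d + Pi.single l 1)) b = 0 := by
    by_contra! h
    refine h0 ?_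
    rw [arcChar_eq_lowSet θ N hs, Finset.expect_comm, Finset.expect_eq_zero, mul_zero]
    intro c hc
    obtain ⟨b, hib, hb⟩ := h c hc
    exact expect_rowSet_eq_zero hθ hib hb hs
  rw [arcChar_eq_lowSet θ N ht, freeRowChar]
  congr 1
  refine Finset.expect_congr rfl fun r hr => ?_
  rw [← expect_lowSet_add hd,
    ← expect_lowSet_smul _ (neg_ne_zero.2 ht) fun c => θ (r ⬝ᵥ N *ᵥ c)]
  refine Finset.expect_congr rfl fun c _ => ?_
  have hrd : r ⬝ᵥ N *ᵥ (d + Pi.single l 1) = 0 := by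
    refine Finset.sum_eq_zero fun a _ => ?_
    rcases lt_or_ge a j with ha | ha
    · rw [rowSet_apply_eq_zero hr ha, zero_mul]
    · rw [hNd a (hij.trans_le ha), mul_zero]
  rw [add_assoc, mulVec_add, dotProduct_add, hrd, add_zero, mulVec_smul, dotProduct_smul,
    smul_eq_mul, neg_mul]

lemma freeRowChar_zero_eq_card {θ : AddChar F ℂ} (hθ : ∃ a, θ a ≠ 1)
    (N : Matrix (Fin n) (Fin n) F) {j : Fin n} (hj : (j : ℕ) = 0) :
    freeRowChar θ N j n =
      ∑ r ∈ rowSet F (fun i j : Fin n => i < j) j, if r ᵥ* N = 0 then 1 else 0 := by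
  have hq : (Fintype.card F : ℂ) ≠ 0 := Nat.cast_ne_zero.2 Fintype.card_ne_zero
  have h1 : ∀ r : Fin n → F, 𝔼 c ∈ lowSet F n n, θ (r ⬝ᵥ N *ᵥ c) =
      if r ᵥ* N = 0 then 1 else 0 := by
    intro r
    simp_rw [dotProduct_mulVec]
    split_ifs with h
    · simp [h, Finset.expect_const (lowSet_nonempty _)]
    · obtain ⟨b, hb⟩ := Function.ne_iff.1 h
      obtain ⟨s, hs⟩ := hθ
      refine expect_eq_zero_of_shift (Pi.single b (s / (r ᵥ* N) b)) ?_ hs ?_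
      · intro c
        simp only [mem_lowSet]
        exact ⟨fun _ b hb => absurd b.2 (by omega), fun _ b hb => absurd b.2 (by omega)⟩
      · intro c
        rw [← AddChar.map_add_eq_mul, dotProduct_add, dotProduct_single]
        have hb' : (r ᵥ* N) b ≠ 0 := hb
        congr 1
        field_simp
        ring
  have hcard : ((rowSet F (fun i j : Fin n => i < j) j).card : ℂ) =
      (Fintype.card F : ℂ) ^ (n - 1) := by
    have h := card_eq_card_mul_of_update (S' := Finset.univ)
      (S := rowSet F (fun i j : Fin n => i < j) j) j 1 (fun c => ?_)
      fun c hc => (mem_rowSet.1 hc).1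
    · rw [Finset.card_univ, Fintype.card_fun, Fintype.card_fin] at h
      have hn : n = n - 1 + 1 := by have := j.2; omega
      refine mul_left_cancel₀ hq ?_
      rw [← h, ← pow_succ', ← hn]
      push_cast
      rfl
    · rw [mem_rowSet]
      simp only [Finset.mem_univ, Function.update_self, true_and, true_iff]
      intro a ha _
      rw [Fin.lt_def, hj]
      have : (j : ℕ) ≠ a := fun h => ha (Fin.ext h)
      omega
  rw [freeRowChar]
  simp_rw [h1]
  rw [Finset.expect_eq_sum_div_card, hcard, hj, Nat.sub_zero]
  field_simp

end ArcIdentities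

section Induction

variable {F : Type*} [Field F] [Fintype F] {n : ℕ}

lemma isPatternOrder_lt : IsPatternOrder fun i j : Fin n => i < j :=
  ⟨fun _ _ h => h, fun _ _ _ => lt_trans⟩

lemma isPatternOrder_lt_and_one_le : IsPatternOrder fun i j : Fin n => i < j ∧ 1 ≤ (i : ℕ) :=
  ⟨fun _ _ h => h.1, fun _ _ _ h h' => ⟨h.1.trans h'.1, h.2⟩⟩

omit [Fintype F] in
lemma mem_patternGroup_lt {g : Matrix (Fin n) (Fin n) F}
    (hg : g ∈ patternGroup F fun i j : Fin n => i < j ∧ 1 ≤ (i : ℕ)) :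
    g ∈ patternGroup F fun i j : Fin n => i < j :=
  ⟨hg.1, fun i j hij h => (hg.2 i j hij h).1⟩

lemma superchar_conj {P : Fin n → Fin n → Prop} (hP : IsPatternOrder P) (θ : F → ℂ)
    (lam : Matrix (Fin n) (Fin n) F) {g y : Matrix (Fin n) (Fin n) F}
    (hg : g ∈ patternGroup F P) (hy : y ∈ patternGroup F P) :
    superchar P θ lam (Ring.inverse y * g * y) = superchar P θ lam g := by
  have hy' := inverse_mem_patternGroup hP hy
  have hsub : Ring.inverse y * g * y - 1 = Ring.inverse y * (g - 1) * y := by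
    rw [mul_sub, sub_mul, mul_one, inverse_mul_patternGroup hP hy]
  obtain ⟨f, hf⟩ : ∃ f : Matrix (Fin n) (Fin n) F → ℂ, ∀ m, f m = θ (-pairF lam m) :=
    ⟨_, fun _ => rfl⟩
  have key : ∑ x ∈ setFinset (patternGroup F P), ∑ z ∈ setFinset (patternGroup F P),
      f (x * (Ring.inverse y * (g - 1) * y) * z) =
      ∑ x ∈ setFinset (patternGroup F P), ∑ z ∈ setFinset (patternGroup F P),
        f (x * (g - 1) * z) := by
    refine Eq.trans ?_ (sum_mul_right_patternGroup hP hy'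
      fun x => ∑ z ∈ setFinset (patternGroup F P), f (x * (g - 1) * z))
    refine Finset.sum_congr rfl fun x _ => ?_
    refine Eq.trans ?_ (sum_mul_left_patternGroup hP hy
      fun z => f (x * Ring.inverse y * (g - 1) * z))
    simp only [mul_assoc]
  rw [superchar_eq_expect hP θ lam hg, superchar_eq_expect hP θ lam
    (mul_mem_patternGroup hP (mul_mem_patternGroup hP hy' hg) hy), hsub]
  simp only [← hf, Finset.expect_eq_sum_div_card, ← Finset.sum_div, key]

lemma rowSet_lt_and_one_le {i : Fin n} (hi : 1 ≤ (i : ℕ)) :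
    rowSet F (fun i j : Fin n => i < j ∧ 1 ≤ (i : ℕ)) i =
      rowSet F (fun i j : Fin n => i < j) i := by
  simp [rowSet, hi]

lemma card_rowSet_of_eq_zero {i : Fin n} (hi : (i : ℕ) = 0) :
    (rowSet F (fun i j : Fin n => i < j ∧ 1 ≤ (i : ℕ)) i).card = 1 := by
  refine Finset.card_eq_one.2 ⟨Pi.single i 1, ?_⟩
  ext r
  rw [mem_rowSet, Finset.mem_singleton]
  constructor
  · rintro ⟨h1, h2⟩
    ext a
    rcases eq_or_ne i a with rfl | h
    · simp [h1]
    · rw [Pi.single_eq_of_ne h.symm]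
      by_contra h0
      have := (h2 a h h0).2
      omega
  · rintro rfl
    exact ⟨by simp, fun a ha h => absurd (Pi.single_eq_of_ne' ha 1) h⟩

lemma arcChar_lt_and_one_le (θ : AddChar F ℂ) {h : Matrix (Fin n) (Fin n) F}
    (hh : h ∈ patternGroup F fun i j : Fin n => i < j ∧ 1 ≤ (i : ℕ)) {i l : Fin n}
    (hi : 1 ≤ (i : ℕ)) (hil : i < l) (t : F) :
    arcChar (fun i j : Fin n => i < j ∧ 1 ≤ (i : ℕ)) θ (h - 1) i l t =
      arcChar (fun i j : Fin n => i < j) θ (h - 1) i l t := by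
  obtain ⟨z, hz⟩ : ∃ z : Fin n, (z : ℕ) = 0 := ⟨⟨0, by have := i.2; omega⟩, rfl⟩
  have hzl : z < l := by
    have := Fin.lt_def.1 hil
    rw [Fin.lt_def]
    omega
  have hcard : (Finset.univ.filter fun a : Fin n =>
        (i < a ∧ 1 ≤ (i : ℕ)) ∧ (a < l ∧ 1 ≤ (a : ℕ))).card =
      (Finset.univ.filter fun a : Fin n => i < a ∧ a < l).card := by
    congr 1
    ext a
    simp only [Finset.mem_filter, Finset.mem_univ, true_and, Fin.lt_def]
    omega
  have hcol : ∀ f : (Fin n → F) → ℂ, (∀ c s, f (Function.update c z s) = f c) →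
      𝔼 c ∈ colSet F (fun i j : Fin n => i < j ∧ 1 ≤ (i : ℕ)) l, f c =
        𝔼 c ∈ colSet F (fun i j : Fin n => i < j) l, f c := by
    intro f hf
    rw [expect_eq_expect_update (S := colSet F (fun i j : Fin n => i < j ∧ 1 ≤ (i : ℕ)) l)
      (S' := colSet F (fun i j : Fin n => i < j) l) z 0]
    · simp only [hf, Finset.expect_const Finset.univ_nonempty]
    · intro c
      rw [mem_colSet, mem_colSet, Function.update_of_ne hzl.ne']
      refine and_congr_right fun _ => forall_congr' fun b => forall_congr' fun _ => ?_
      rcases eq_or_ne b z with rfl | hb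
      · simp [hzl]
      · have : 1 ≤ (b : ℕ) := by
          have : (b : ℕ) ≠ z := fun h => hb (Fin.ext h)
          omega
        simp [hb, this]
    · intro c hc
      by_contra h0
      have := ((mem_colSet.1 hc).2 z hzl.ne h0).2
      omega
  have hupd : ∀ (c : Fin n → F) (s : F), (h - 1) *ᵥ Function.update c z s = (h - 1) *ᵥ c := by
    intro c s
    ext a
    simp only [mulVec, dotProduct]
    refine Finset.sum_congr rfl fun b _ => ?_
    rcases eq_or_ne b z with rfl | hb
    · have : (h - 1) a b = 0 := by
        by_contra h0
        have := Fin.lt_def.1 (sub_one_apply_ne_zero hh h0).1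
        omega
      rw [this, zero_mul, zero_mul]
    · rw [Function.update_of_ne hb]
  simp only [arcChar]
  congr 1
  · rw [hcard]
  · rw [rowSet_lt_and_one_le hi]
    refine Finset.expect_congr rfl fun r _ => hcol _ fun c s => ?_
    rw [hupd]

lemma superchar_lt_and_one_le (θ : AddChar F ℂ) {lam : Matrix (Fin n) (Fin n) F}
    (hsupp : ∀ i l, lam i l ≠ 0 → i < l ∧ 1 ≤ (i : ℕ))
    (hrow : ∀ i l l', lam i l ≠ 0 → lam i l' ≠ 0 → l = l')
    (hcol : ∀ i i' l, lam i l ≠ 0 → lam i' l ≠ 0 → i = i') {h : Matrix (Fin n) (Fin n) F}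
    (hh : h ∈ patternGroup F fun i j : Fin n => i < j ∧ 1 ≤ (i : ℕ)) :
    superchar (fun i j : Fin n => i < j ∧ 1 ≤ (i : ℕ)) θ lam h =
      superchar (fun i j : Fin n => i < j) θ lam h := by
  rw [superchar_eq_prod isPatternOrder_lt_and_one_le θ hsupp hrow hcol hh,
    superchar_eq_prod isPatternOrder_lt θ (fun i l h => (hsupp i l h).1) hrow hcol
      (mem_patternGroup_lt hh)]
  refine Finset.prod_congr rfl fun i _ => Finset.prod_congr rfl fun l _ => ?_
  by_cases h0 : lam i l = 0
  · rw [h0, arcChar_zero, arcChar_zero]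
  · exact arcChar_lt_and_one_le θ hh (hsupp i l h0).2 (hsupp i l h0).1 _

lemma conj_mem_iff {g y : Matrix (Fin n) (Fin n) F}
    (hg : g ∈ patternGroup F fun i j : Fin n => i < j)
    (hy : y ∈ patternGroup F fun i j : Fin n => i < j) {z : Fin n} (hz : (z : ℕ) = 0) :
    Ring.inverse y * g * y ∈ (patternGroup F fun i j : Fin n => i < j ∧ 1 ≤ (i : ℕ)) ↔
      (Ring.inverse y) z ᵥ* (g - 1) = 0 := by
  have hP := isPatternOrder_lt (n := n)
  have hconj := mul_mem_patternGroup hP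
    (mul_mem_patternGroup hP (inverse_mem_patternGroup hP hy) hg) hy
  have hsub : Ring.inverse y * g * y - 1 = Ring.inverse y * (g - 1) * y := by
    rw [mul_sub, sub_mul, mul_one, inverse_mul_patternGroup hP hy]
  have hrow : (Ring.inverse y * g * y - 1) z = (Ring.inverse y) z ᵥ* (g - 1) ᵥ* y := by
    rw [hsub]
    rfl
  constructor
  · intro hH
    have h0 : (Ring.inverse y) z ᵥ* (g - 1) ᵥ* y = 0 := by
      rw [← hrow]
      ext j
      by_contra h
      have := (sub_one_apply_ne_zero hH h).2
      omega
    have h1 := congrArg (· ᵥ* Ring.inverse y) h0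
    simpa [vecMul_vecMul, mul_assoc, mul_inverse_patternGroup hP hy] using h1
  · intro h0
    rw [h0, zero_vecMul] at hrow
    refine ⟨hconj.1, fun i j hij h => ⟨hconj.2 i j hij h, ?_⟩⟩
    by_contra hi
    have hiz : i = z := Fin.ext (by omega)
    subst hiz
    have := congrFun hrow j
    rw [Matrix.sub_apply, Matrix.one_apply_ne hij, sub_zero] at this
    exact h this

lemma card_conj_mem {θ : AddChar F ℂ} (hθ : ∃ a, θ a ≠ 1) {g : Matrix (Fin n) (Fin n) F}
    (hg : g ∈ patternGroup F fun i j : Fin n => i < j) {z : Fin n} (hz : (z : ℕ) = 0) :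
    ((setFinset (patternGroup F fun i j : Fin n => i < j ∧ 1 ≤ (i : ℕ))).card : ℂ)⁻¹ *
      ∑ y ∈ setFinset (patternGroup F fun i j : Fin n => i < j),
        (if Ring.inverse y * g * y ∈ patternGroup F fun i j : Fin n => i < j ∧ 1 ≤ (i : ℕ)
          then 1 else 0) = freeRowChar θ (g - 1) z n := by
  have h1 : ∑ y ∈ setFinset (patternGroup F fun i j : Fin n => i < j),
      (if Ring.inverse y * g * y ∈ patternGroup F fun i j : Fin n => i < j ∧ 1 ≤ (i : ℕ)
        then (1 : ℂ) else 0) =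
      ∏ i, ∑ r ∈ rowSet F (fun i j : Fin n => i < j) i,
        if i = z then (if r ᵥ* (g - 1) = 0 then 1 else 0) else 1 := by
    rw [Finset.prod_univ_sum]
    have h2 := sum_inverse_patternGroup (isPatternOrder_lt (n := n))
      fun y : Matrix (Fin n) (Fin n) F => if y z ᵥ* (g - 1) = 0 then (1 : ℂ) else 0
    simp only [Finset.prod_ite_eq', Finset.mem_univ, if_true]
    refine Eq.trans (Finset.sum_congr rfl fun y hy => ?_) (h2.trans (sum_patternGroup_rows _))
    simp only [conj_mem_iff hg (mem_setFinset.1 hy) hz]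
  rw [h1, card_patternGroup_rows, Fintype.card_piFinset, Nat.cast_prod, ← Finset.prod_inv_distrib,
    ← Finset.prod_mul_distrib, Finset.prod_eq_single z]
  · rw [card_rowSet_of_eq_zero hz, freeRowChar_zero_eq_card hθ _ hz]
    simp
  · intro i _ hi
    have : 1 ≤ (i : ℕ) := by
      have : (i : ℕ) ≠ z := fun h => hi (Fin.ext h)
      omega
    rw [rowSet_lt_and_one_le this]
    simp only [if_neg hi, Finset.sum_const, nsmul_eq_mul, mul_one]
    exact inv_mul_cancel₀ (Nat.cast_ne_zero.2 (rowSet_nonempty i).card_pos.ne')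
  · simp

lemma Ind_superchar {θ : AddChar F ℂ} (hθ : ∃ a, θ a ≠ 1) {lam : Matrix (Fin n) (Fin n) F}
    (hsupp : ∀ i l, lam i l ≠ 0 → i < l ∧ 1 ≤ (i : ℕ))
    (hrow : ∀ i l l', lam i l ≠ 0 → lam i l' ≠ 0 → l = l')
    (hcol : ∀ i i' l, lam i l ≠ 0 → lam i' l ≠ 0 → i = i') {g : Matrix (Fin n) (Fin n) F}
    (hg : g ∈ patternGroup F fun i j : Fin n => i < j) {z : Fin n} (hz : (z : ℕ) = 0) :
    Ind (patternGroup F fun i j : Fin n => i < j)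
        (patternGroup F fun i j : Fin n => i < j ∧ 1 ≤ (i : ℕ))
        (superchar (fun i j : Fin n => i < j ∧ 1 ≤ (i : ℕ)) θ lam) g =
      superchar (fun i j : Fin n => i < j) θ lam g * freeRowChar θ (g - 1) z n := by
  rw [← card_conj_mem hθ hg hz, Ind, mul_left_comm (superchar _ _ _ _),
    Finset.mul_sum _ _ (superchar _ _ _ _)]
  congr 1
  refine Finset.sum_congr rfl fun y hy => ?_
  split_ifs with h
  · rw [superchar_lt_and_one_le θ hsupp hrow hcol h,
      superchar_conj isPatternOrder_lt θ lam hg (mem_setFinset.1 hy), mul_one]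
  · rw [mul_zero]

end Induction

section Recursion

variable {F : Type*} [Field F] [Fintype F] {n : ℕ}

lemma charOfComb_eq_linearCombination (P : Fin n → Fin n → Prop) (θ : F → ℂ) (c : SPF F →₀ ℂ)
    (g : Matrix (Fin n) (Fin n) F) : charOfComb P θ c g =
      Finsupp.linearCombination ℂ (fun lam => superchar P θ (toMat F n lam) g) c := rfl

lemma charOfComb_single (P : Fin n → Fin n → Prop) (θ : F → ℂ) (mu : SPF F)
    (g : Matrix (Fin n) (Fin n) F) :
    charOfComb P θ (Finsupp.single mu 1) g = superchar P θ (toMat F n mu) g := by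
  simp [charOfComb_eq_linearCombination]

/-- `mu` encodes an `F`-labeled set partition of `{1, …, n}`. -/
structure IsLabeledPartition (n : ℕ) (mu : SPF F) : Prop where
  supp : ∀ i l, mu i l ≠ 0 → 1 ≤ i ∧ i < l ∧ l ≤ n
  row : ∀ i l l', mu i l ≠ 0 → mu i l' ≠ 0 → l = l'
  col : ∀ i i' l, mu i l ≠ 0 → mu i' l ≠ 0 → i = i'

namespace IsLabeledPartition

omit [Fintype F] in
lemma erase {mu : SPF F} (h : IsLabeledPartition n mu) (j l : ℕ) :
    IsLabeledPartition n (updArc mu j l 0) := by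
  have key : ∀ a b, updArc mu j l 0 a b ≠ 0 → mu a b ≠ 0 := by
    intro a b hab h0
    simp [updArc, h0] at hab
  exact ⟨fun i l hi => h.supp i l (key _ _ hi),
    fun i l l' hl hl' => h.row i l l' (key _ _ hl) (key _ _ hl'),
    fun i i' l hi hi' => h.col i i' l (key _ _ hi) (key _ _ hi')⟩

omit [Fintype F] in
lemma adjoin {mu : SPF F} (h : IsLabeledPartition n mu) {j l : ℕ} (hj : 1 ≤ j) (hjl : j < l)
    (hl : l ≤ n) (hrow : ∀ b, mu j b = 0) (hcol : ∀ a, mu a l = 0) (t : F) :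
    IsLabeledPartition n (updArc mu j l t) := by
  have key : ∀ a b, updArc mu j l t a b ≠ 0 →
      (a = j ∧ b = l) ∨ (mu a b ≠ 0 ∧ a ≠ j ∧ b ≠ l) := by
    intro a b hab
    by_cases h' : a = j ∧ b = l
    · exact Or.inl h'
    · have h0 : mu a b ≠ 0 := by simpa [updArc, h'] using hab
      exact Or.inr ⟨h0, fun e => h0 (e ▸ hrow b), fun e => h0 (e ▸ hcol a)⟩
  refine ⟨fun a b hab => ?_, fun a b b' hb hb' => ?_, fun a a' b ha ha' => ?_⟩
  · rcases key a b hab with ⟨rfl, rfl⟩ | ⟨h0, -, -⟩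
    · exact ⟨hj, hjl, hl⟩
    · exact h.supp a b h0
  · rcases key a b hb with ⟨h1, h2⟩ | ⟨h0, h1, -⟩ <;>
      rcases key a b' hb' with ⟨h3, h4⟩ | ⟨h0', h3, -⟩
    · rw [h2, h4]
    · exact absurd h1 h3
    · exact absurd h3 h1
    · exact h.row a b b' h0 h0'
  · rcases key a b ha with ⟨h1, h2⟩ | ⟨h0, -, h2⟩ <;>
      rcases key a' b ha' with ⟨h3, h4⟩ | ⟨h0', -, h4⟩
    · rw [h1, h3]
    · exact absurd h2 h4
    · exact absurd h4 h2
    · exact h.col a a' b h0 h0'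

lemma superchar_eq_prod {mu : SPF F} (h : IsLabeledPartition n mu) (θ : AddChar F ℂ)
    {g : Matrix (Fin n) (Fin n) F} (hg : g ∈ patternGroup F fun i j : Fin n => i < j) :
    superchar (fun i j : Fin n => i < j) θ (toMat F n mu) g =
      ∏ i : Fin n, ∏ l : Fin n,
        arcChar (fun i j : Fin n => i < j) θ (g - 1) i l (mu (i + 1) (l + 1)) := by
  refine _root_.superchar_eq_prod isPatternOrder_lt θ (fun i l hi => ?_)
    (fun i l l' hl hl' => Fin.ext ?_) (fun i i' l hi hi' => Fin.ext ?_) hg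
  · have := (h.supp _ _ hi).2.1
    rw [Fin.lt_def]
    omega
  · exact Nat.succ_injective (h.row _ _ _ hl hl')
  · exact Nat.succ_injective (h.col _ _ _ hi hi')

lemma superchar_eq_mul_arcChar {mu : SPF F} (h : IsLabeledPartition n mu) (θ : AddChar F ℂ)
    {g : Matrix (Fin n) (Fin n) F} (hg : g ∈ patternGroup F fun i j : Fin n => i < j)
    (i l : Fin n) :
    superchar (fun i j : Fin n => i < j) θ (toMat F n mu) g =
      superchar (fun i j : Fin n => i < j) θ (toMat F n (updArc mu (i + 1) (l + 1) 0)) g *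
        arcChar (fun i j : Fin n => i < j) θ (g - 1) i l (mu (i + 1) (l + 1)) := by
  have hprod : ∀ X : ℂ, ∏ a : Fin n, ∏ b : Fin n, (if a = i ∧ b = l then X else 1) = X := by
    intro X
    rw [Finset.prod_eq_single i (fun a _ ha => by simp [ha]) (by simp),
      Finset.prod_eq_single l (fun b _ hb => by simp [hb]) (by simp)]
    simp
  rw [h.superchar_eq_prod θ hg, (h.erase _ _).superchar_eq_prod θ hg,
    ← hprod (arcChar _ θ (g - 1) i l _), ← Finset.prod_mul_distrib]
  refine Finset.prod_congr rfl fun a _ => ?_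
  rw [← Finset.prod_mul_distrib]
  refine Finset.prod_congr rfl fun b _ => ?_
  by_cases hab : a = i ∧ b = l
  · obtain ⟨rfl, rfl⟩ := hab
    simp [updArc, arcChar_zero]
  · have : ¬((a : ℕ) + 1 = i + 1 ∧ (b : ℕ) + 1 = l + 1) := fun h' =>
      hab ⟨Fin.ext (by omega), Fin.ext (by omega)⟩
    rw [if_neg hab, mul_one, updArc, if_neg this]

lemma superchar_updArc {mu : SPF F} {i l : Fin n} {t : F}
    (h : IsLabeledPartition n (updArc mu (i + 1) (l + 1) t)) (θ : AddChar F ℂ)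
    {g : Matrix (Fin n) (Fin n) F} (hg : g ∈ patternGroup F fun i j : Fin n => i < j)
    (h0 : mu (i + 1) (l + 1) = 0) :
    superchar (fun i j : Fin n => i < j) θ (toMat F n (updArc mu (i + 1) (l + 1) t)) g =
      superchar (fun i j : Fin n => i < j) θ (toMat F n mu) g *
        arcChar (fun i j : Fin n => i < j) θ (g - 1) i l t := by
  have : updArc (updArc mu (i + 1) (l + 1) t) (i + 1) (l + 1) 0 = mu := by
    ext a b
    by_cases hab : a = i + 1 ∧ b = l + 1
    · simp [updArc, hab, h0]
    · simp [updArc, hab]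
  rw [h.superchar_eq_mul_arcChar θ hg i l, this]
  simp [updArc]

theorem charOfComb_rstar {θ : AddChar F ℂ} (hθ : ∃ a, θ a ≠ 1) {g : Matrix (Fin n) (Fin n) F}
    (hg : g ∈ patternGroup F fun i j : Fin n => i < j) :
    ∀ {l : ℕ} (_ : l ≤ n) {j : Fin n} (_ : (j : ℕ) < l) {mu : SPF F}
      (_ : IsLabeledPartition n mu) (_ : ∀ k, mu (j + 1) k = 0),
      charOfComb (fun i j : Fin n => i < j) θ (rstar (j + 1) l mu) g =
        superchar (fun i j : Fin n => i < j) θ (toMat F n mu) g * freeRowChar θ (g - 1) j l := by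
  have hN : ∀ i j, (g - 1) i j ≠ 0 → i < j := fun i j h => sub_one_apply_ne_zero hg h
  intro l
  induction l with
  | zero => exact fun _ j hj => absurd hj (Nat.not_lt_zero _)
  | succ l ih =>
    intro hl j hjl mu hmu hrow
    rcases Nat.lt_succ_iff_lt_or_eq.1 hjl with hjl | rfl
    swap
    · rw [rstar, dif_pos le_rfl, if_pos rfl, charOfComb_single, freeRowChar_self θ hN, mul_one]
    obtain ⟨L, rfl⟩ : ∃ L : Fin n, (L : ℕ) = l := ⟨⟨l, hl⟩, rfl⟩
    have ih' := @ih L.2.le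
    rw [freeRowChar_succ θ (g - 1) hjl, mul_add, Finset.mul_sum, rstar,
      dif_neg (by omega), Nat.add_sub_cancel]
    have hmap : ∀ (c : SPF F →₀ ℂ) (d : F → SPF F →₀ ℂ),
        charOfComb (fun i j : Fin n => i < j) θ
          (c + ∑ t ∈ Finset.univ.filter (fun t : F => t ≠ 0), d t) g =
        charOfComb (fun i j : Fin n => i < j) θ c g +
          ∑ t ∈ Finset.univ.filter (fun t : F => t ≠ 0),
            charOfComb (fun i j : Fin n => i < j) θ (d t) g := by
      intro c d
      simp only [charOfComb_eq_linearCombination, map_add, map_sum]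
    split_ifs with h2 h3 h4
    · obtain ⟨i', hi', hi⟩ := h2
      obtain ⟨i, rfl⟩ : ∃ i : Fin n, (i : ℕ) + 1 = i' :=
        ⟨⟨i' - 1, by omega⟩, Nat.sub_add_cancel (hmu.supp _ _ hi).1⟩
      have hij : i < j := by
        rw [Fin.lt_def]
        omega
      rw [charOfComb_eq_linearCombination, map_nsmul, ← charOfComb_eq_linearCombination,
        ih' hjl hmu hrow, hmu.superchar_eq_mul_arcChar θ hg i L]
      have hterm : ∀ t ∈ Finset.univ.filter (fun t : F => t ≠ 0),
          superchar (fun i j : Fin n => i < j) θ (toMat F n (updArc mu (i + 1) (L + 1) 0)) g *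
            arcChar (fun i j : Fin n => i < j) θ (g - 1) i L (mu (i + 1) (L + 1)) *
            arcChar (fun i j : Fin n => i < j) θ (g - 1) j L t =
          superchar (fun i j : Fin n => i < j) θ (toMat F n (updArc mu (i + 1) (L + 1) 0)) g *
            arcChar (fun i j : Fin n => i < j) θ (g - 1) i L (mu (i + 1) (L + 1)) *
            freeRowChar θ (g - 1) j L := by
        intro t ht
        rw [mul_assoc, arcChar_mul_arcChar hθ _ hij hi (Finset.mem_filter.1 ht).2, ← mul_assoc]
      rw [Finset.sum_congr rfl hterm, Finset.sum_const, Finset.filter_ne',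
        Finset.card_erase_of_mem (Finset.mem_univ _), Finset.card_univ, ← succ_nsmul',
        Nat.sub_add_cancel Fintype.card_pos]
    · exact absurd (hrow _) h3
    · have hk := Classical.choose_spec h4
      generalize Classical.choose h4 = k' at hk ⊢
      obtain ⟨hjk, hk⟩ := hk
      have hks := hmu.supp _ _ hk
      obtain ⟨k, rfl⟩ : ∃ k : Fin n, (k : ℕ) + 1 = k' :=
        ⟨⟨k' - 1, by omega⟩, Nat.sub_add_cancel hks.1⟩
      have hjk : j < k := by
        rw [Fin.lt_def]
        omega
      have hrow' : ∀ b, updArc mu (k + 1) (L + 1) 0 (j + 1) b = 0 := by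
        intro b
        simp [updArc, hrow]
      have hcol' : ∀ a, updArc mu (k + 1) (L + 1) 0 a (L + 1) = 0 := by
        intro a
        by_contra h0
        by_cases ha : a = k + 1
        · simp [updArc, ha] at h0
        · exact ha (hmu.col _ _ _ (by simpa [updArc, ha] using h0) hk)
      rw [hmap, ih' hjl hmu hrow]
      refine congrArg (_ + ·) (Finset.sum_congr rfl fun t ht => ?_)
      have ht := (Finset.mem_filter.1 ht).2
      have hmu' := (hmu.erase (k + 1) (L + 1)).adjoin (j := j + 1) (by omega) (by omega) hl
        hrow' hcol' t
      rw [ih' (j := k) (by omega) hmu', hmu'.superchar_updArc θ hg (hrow' _),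
        hmu.superchar_eq_mul_arcChar θ hg k L, mul_assoc, mul_assoc,
        ← arcChar_mul_arcChar hθ _ hjk ht hk, mul_comm (arcChar _ _ _ j _ _)]
      intro b
      have hkj : (k : ℕ) ≠ j := fun h => hjk.ne' (Fin.ext h)
      by_cases hb : b = L + 1
      · simp [updArc, hb, hkj]
      · have : mu (k + 1) b = 0 := by
          by_contra h0
          exact hb (hmu.row _ _ _ h0 hk)
        simp [updArc, hb, this]
    · have hcol : ∀ a, mu a (L + 1) = 0 := by
        intro a
        by_contra h0
        rcases lt_trichotomy a (j + 1) with h | rfl | h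
        · exact h2 ⟨a, h, h0⟩
        · exact h0 (hrow _)
        · exact h4 ⟨a, h, h0⟩
      rw [hmap, ih' hjl hmu hrow]
      refine congrArg (_ + ·) (Finset.sum_congr rfl fun t _ => ?_)
      rw [charOfComb_single, (hmu.adjoin (by omega) (by omega) hl hrow hcol t).superchar_updArc
        θ hg (hrow _)]

end IsLabeledPartition

end Recursion

theorem induced_supercharacter_alternate_embedding
    {n : ℕ} (hn : 0 < n) (F : Type*) [Field F] [Fintype F]
    (θ : F → ℂ) (hθadd : ∀ a b, θ (a + b) = θ a * θ b)
    (hθne : ∀ a, θ a ≠ 0) (hθnt : ∃ a, θ a ≠ 1)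
    (mu : SPF F)
    (hsupp : ∀ i j, mu i j ≠ 0 → 2 ≤ i ∧ i < j ∧ j ≤ n)
    (hrow : ∀ i j j', mu i j ≠ 0 → mu i j' ≠ 0 → j = j')
    (hcol : ∀ i i' j, mu i j ≠ 0 → mu i' j ≠ 0 → i = i') :
    ∀ g ∈ patternGroup F (fun i j : Fin n => i < j),
      Ind (patternGroup F (fun i j : Fin n => i < j))
          (patternGroup F (fun i j : Fin n => i < j ∧ 1 ≤ (i : ℕ)))
          (superchar (fun i j : Fin n => i < j ∧ 1 ≤ (i : ℕ)) θ (toMat F n mu)) g =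
        charOfComb (fun i j : Fin n => i < j) θ (rstar 1 n mu) g := by
  intro g hg
  have hθ0 : θ 0 = 1 := by
    have h := hθadd 0 0
    rw [add_zero] at h
    exact (mul_eq_left₀ (hθne 0)).1 h.symm
  obtain ⟨ψ, rfl⟩ : ∃ ψ : AddChar F ℂ, ⇑ψ = θ :=
    ⟨{ toFun := θ, map_zero_eq_one' := hθ0, map_add_eq_mul' := hθadd }, rfl⟩
  have hmu : IsLabeledPartition n mu :=
    ⟨fun i j h => ⟨one_le_two.trans (hsupp i j h).1, (hsupp i j h).2⟩, hrow, hcol⟩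
  have hone : ∀ k, mu (((⟨0, hn⟩ : Fin n) : ℕ) + 1) k = 0 := by
    intro k
    by_contra h
    exact absurd (hsupp _ _ h).1 (by simp)
  rw [Ind_superchar hθnt _ _ _ hg (z := ⟨0, hn⟩) rfl]
  · exact (hmu.charOfComb_rstar hθnt hg le_rfl hn hone).symm
  · intro i l h
    have := hsupp _ _ h
    rw [Fin.lt_def]
    omega
  · exact fun i l l' h h' => Fin.ext (Nat.succ_injective (hrow _ _ _ h h'))
  · exact fun i i' l h h' => Fin.ext (Nat.succ_injective (hcol _ _ _ h h'))
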